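/- arXiv:1407.1018 — 6 statements merged into one kernel-verified Lean document; each statement's English description precedes it below -/
import Mathlib

section
/- Let p > 3 be prime and let k be an integer with 1 ≤ k ≤ 8. Then, as real numbers, (1/(p⁴−p³)) · Σ_{D∈H_{p,4}} ((1 − p^{−1/2})·(2 + (1 − a_p(D))·p^{−1/2}))^k = (1 − p^{−1/2})^k · [ (2/(k+2))·C(2k+1,k) − 2·Σ_{l=1}^{⌊k/2⌋} C(2k+1, k−2l)·(2l+1)/((k+2l+2)·p^{l+1}) ] + (1 − p^{−1/2})^k · p^{−1/2} · [ (4/(k+3))·C(2k+1, k−1) − 4·Σ_{l=1}^{⌊(k+1)/2⌋} (k²+k+4l²+4l)·(2k+1)!·(2l+1)/((k+2l+3)!·(k−2l+1)!·p^{l+1}) ]. (This is the d=4 moment formula of Theorem 7 in the range k ≤ 8, where all the Hecke-trace terms tr_{2l+2}(T_p) vanish because the relevant spaces of cusp forms of weight at most 10 for SL_2(ℤ) are zero.) -/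
open Polynomial Finset
open scoped Classical

/-- The quadratic character of a field: `χ(0)=0`, `χ(a)=1` if `a` is a nonzero square,
`χ(a)=-1` otherwise. -/
noncomputable def quadChar (F : Type*) [Field F] (a : F) : ℤ :=
  if a = 0 then 0 else if IsSquare a then 1 else -1

/-- `a_q(D) = -Σ_{x ∈ F_q} χ(D(x))`. -/
noncomputable def aQ {F : Type*} [Field F] [Fintype F] (D : Polynomial F) : ℤ :=
  -∑ x : F, quadChar F (D.eval x)


namespace QM

set_option linter.unusedSectionVars false

section dual

variable {F : Type*} [Field F] [Fintype F] [DecidableEq F]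

/-- polynomial with given coefficients -/
noncomputable def pol {d : ℕ} (c : Fin d → F) : F[X] := ∑ i, C (c i) * X ^ (i : ℕ)

lemma pol_eval {d : ℕ} (c : Fin d → F) (x : F) : (pol c).eval x = ∑ i, c i * x ^ (i : ℕ) := by
  simp [pol, eval_finsetSum]

lemma pol_degree {d : ℕ} (c : Fin d → F) : (pol c).degree < d := by
  unfold pol
  apply (degree_sum_le _ _).trans_lt
  rw [Finset.sup_lt_iff (by exact WithBot.bot_lt_coe d)]
  intro i _
  exact (degree_C_mul_X_pow_le _ _).trans_lt (by exact_mod_cast i.2)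

lemma pol_coeff {d : ℕ} (c : Fin d → F) (i : Fin d) : (pol c).coeff i = c i := by
  unfold pol
  simp [finsetSum_coeff, coeff_C_mul, coeff_X_pow, Fin.val_inj]

lemma exists_pol {d : ℕ} (Q : F[X]) (h : Q.degree < d) : ∃ c : Fin d → F, pol c = Q := by
  refine ⟨fun i => Q.coeff i, ?_⟩
  ext n
  by_cases hn : n < d
  · exact pol_coeff (fun i : Fin d => Q.coeff i) ⟨n, hn⟩
  · rw [coeff_eq_zero_of_degree_lt, coeff_eq_zero_of_degree_lt]
    · exact h.trans_le (by exact_mod_cast not_lt.mp hn)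
    · exact (pol_degree _).trans_le (by exact_mod_cast not_lt.mp hn)

lemma pol_injective {d : ℕ} : Function.Injective (pol : (Fin d → F) → F[X]) := by
  intro a b h
  funext i
  rw [← pol_coeff a i, h, pol_coeff]

/-- node weights -/
def wt (S : Finset F) (x : F) : F := ∏ y ∈ S.erase x, (x - y)

lemma wt_ne_zero (S : Finset F) (x : F) : wt S x ≠ 0 := by
  unfold wt
  rw [Finset.prod_ne_zero_iff]
  intro y hy
  rw [sub_ne_zero]
  exact fun h => (Finset.mem_erase.mp hy).1 h.symm

lemma sum_wt (S : Finset F) (H : F[X]) (h : H.degree < #S) :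
    ∑ x ∈ S, H.eval x / wt S x = H.coeff (#S - 1) := by
  have := Lagrange.coeff_eq_sum (s := S) (v := id) (Set.injOn_id _) h
  rw [this]; rfl

lemma dual_param (S : Finset F) (d : ℕ) (u : F → F)
    (hu : ∀ i < d, ∑ x ∈ S, u x * x ^ i = 0) :
    ∃ Q : F[X], Q.degree < ((#S - d : ℕ) : WithBot ℕ) ∧ ∀ x ∈ S, u x = Q.eval x / wt S x := by
  set Q := Lagrange.interpolate S id (fun x => u x * wt S x) with hQ
  have hdeg : Q.degree < #S := Lagrange.degree_interpolate_lt _ (Set.injOn_id _)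
  have hev : ∀ x ∈ S, Q.eval x = u x * wt S x := fun x hx =>
    Lagrange.eval_interpolate_at_node (fun x => u x * wt S x) (Set.injOn_id _) hx
  have hev' : ∀ x ∈ S, u x = Q.eval x / wt S x := fun x hx => by
    rw [hev x hx, mul_div_cancel_right₀ _ (wt_ne_zero S x)]
  refine ⟨Q, ?_, hev'⟩
  by_contra hcon
  have hQ0 : Q ≠ 0 := by
    rintro h0
    rw [h0] at hcon
    simp at hcon
  rw [not_lt, degree_eq_natDegree hQ0] at hcon
  rw [degree_eq_natDegree hQ0] at hdeg
  have h1 : #S - d ≤ Q.natDegree := by exact_mod_cast hcon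
  have h2 : Q.natDegree < #S := by exact_mod_cast hdeg
  have h3 : #S - 1 - Q.natDegree < d := by omega
  have h4 := hu _ h3
  have h5 := sum_wt S (Q * X ^ (#S - 1 - Q.natDegree)) (by
    rw [degree_mul, degree_X_pow, degree_eq_natDegree hQ0]
    norm_cast; omega)
  have h6 : ∑ x ∈ S, (Q * X ^ (#S - 1 - Q.natDegree)).eval x / wt S x
      = ∑ x ∈ S, u x * x ^ (#S - 1 - Q.natDegree) := by
    apply Finset.sum_congr rfl
    intro x hx
    rw [hev' x hx]
    simp only [eval_mul, eval_pow, eval_X]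
    ring
  rw [← h6, h5] at h4
  rw [coeff_mul_X_pow'] at h4
  rw [if_pos (by omega)] at h4
  rw [show #S - 1 - (#S - 1 - Q.natDegree) = Q.natDegree by omega] at h4
  exact hQ0 (leadingCoeff_eq_zero.mp h4)

/-- complex version of the quadratic character -/
noncomputable def chC (F : Type*) [Field F] [Fintype F] [DecidableEq F] : MulChar F ℂ :=
  (quadraticChar F).ringHomComp (Int.castRingHom ℂ)

lemma chC_apply (a : F) : chC F a = ((quadraticChar F a : ℤ) : ℂ) := rfl

lemma chC_ne_one (hF : ringChar F ≠ 2) : chC F ≠ 1 := by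
  intro h
  obtain ⟨a, ha⟩ := quadraticChar_exists_neg_one' hF
  have h1 : chC F a = 1 := by rw [h]; simp
  rw [chC_apply, ha] at h1
  norm_num at h1

lemma chC_quad : (chC F).IsQuadratic := quadraticChar_isQuadratic F |>.comp _

lemma gauss_shift (hF : ringChar F ≠ 2) (ψ : AddChar F ℂ) (a : F) :
    ∑ u, chC F u * ψ (u * a) = chC F a * gaussSum (chC F) ψ := by
  by_cases ha : a = 0
  · subst ha
    simp only [mul_zero, AddChar.map_zero_eq_one, mul_one]
    rw [MulChar.sum_eq_zero_of_ne_one (chC_ne_one hF), MulChar.map_zero, zero_mul]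
  · have h1 := gaussSum_mulShift (chC F) ψ (Units.mk0 a ha)
    have h2 : chC F a * chC F a = 1 := by
      rw [chC_apply, ← Int.cast_mul, ← pow_two, quadraticChar_sq_one ha]; simp
    rw [← h1]
    simp only [Units.val_mk0]
    rw [← mul_assoc, h2, one_mul, gaussSum]
    apply Finset.sum_congr rfl
    intro u _
    rw [AddChar.mulShift_apply, mul_comm a]

lemma psi_sum {ι : Type*} (ψ : AddChar F ℂ) (s : Finset ι) (f : ι → F) :
    ψ (∑ i ∈ s, f i) = ∏ i ∈ s, ψ (f i) := by
  induction s using Finset.induction_on with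
  | empty => simp
  | insert a s ha ih => rw [Finset.sum_insert ha, Finset.prod_insert ha, AddChar.map_add_eq_mul, ih]

lemma fourier (hF : ringChar F ≠ 2) (ψ : AddChar F ℂ) (hψ : ψ.IsPrimitive) (S : Finset F) (d : ℕ) :
    gaussSum (chC F) ψ ^ #S * ∑ c : Fin d → F, ∏ x ∈ S, chC F ((X ^ d + pol c).eval x)
      = (Fintype.card F : ℂ) ^ d * ∑ u : S → F,
        if (∀ i : Fin d, ∑ x : S, u x * (x : F) ^ (i : ℕ) = 0) then
          (∏ x : S, chC F (u x)) * ψ (∑ x : S, u x * (x : F) ^ d) else 0 := by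
  have h1 : ∀ c : Fin d → F, gaussSum (chC F) ψ ^ #S * ∏ x ∈ S, chC F ((X ^ d + pol c).eval x)
      = ∑ u : S → F, (∏ x : S, chC F (u x)) * (ψ (∑ x : S, u x * (x : F) ^ d) *
          ∏ i : Fin d, ψ (c i * ∑ x : S, u x * (x : F) ^ (i : ℕ))) := by
    intro c
    rw [← Finset.prod_const, ← Finset.prod_mul_distrib]
    rw [← Finset.prod_coe_sort]
    have : ∀ x : S, gaussSum (chC F) ψ * chC F ((X ^ d + pol c).eval (x : F))
      = ∑ u, chC F u * ψ (u * ((X ^ d + pol c).eval (x : F))) := fun x => by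
        rw [gauss_shift hF, mul_comm]
    rw [Finset.prod_congr rfl (fun x _ => this x), Finset.prod_univ_sum]
    simp only [Fintype.piFinset_univ]
    apply Finset.sum_congr rfl
    intro u _
    rw [Finset.prod_mul_distrib]
    congr 1
    rw [← psi_sum, ← psi_sum, ← AddChar.map_add_eq_mul]
    congr 1
    simp only [eval_add, eval_pow, eval_X, pol_eval, mul_add, Finset.sum_add_distrib]
    congr 1
    simp only [Finset.mul_sum]
    rw [Finset.sum_comm]
    apply Finset.sum_congr rfl; intro i _
    apply Finset.sum_congr rfl; intro x _
    ring
  rw [Finset.mul_sum, Finset.sum_congr rfl (fun c _ => h1 c), Finset.sum_comm, Finset.mul_sum]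
  apply Finset.sum_congr rfl
  intro u _
  rw [← Finset.mul_sum, ← Finset.mul_sum]
  have h2 : ∑ c : Fin d → F, ∏ i : Fin d, ψ (c i * ∑ x : S, u x * (x : F) ^ (i : ℕ))
      = ∏ i : Fin d, ∑ c : F, ψ (c * ∑ x : S, u x * (x : F) ^ (i : ℕ)) := by
    rw [Finset.prod_univ_sum]; simp only [Fintype.piFinset_univ]
  rw [h2]
  simp_rw [AddChar.sum_mulShift _ hψ]
  split_ifs with h
  · have h3 : ∀ i : Fin d, (((if ∑ x : S, u x * (x : F) ^ (i : ℕ) = 0 then Fintype.card F else 0 : ℕ)) : ℂ)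
        = (Fintype.card F : ℂ) := fun i => by rw [if_pos (h i)]
    rw [Finset.prod_congr rfl (fun i _ => h3 i), Finset.prod_const, Finset.card_univ, Fintype.card_fin]
    ring
  · push Not at h
    obtain ⟨i, hi⟩ := h
    rw [Finset.prod_eq_zero (Finset.mem_univ i) (by rw [if_neg hi, Nat.cast_zero])]
    simp

lemma gauss_ne (hF : ringChar F ≠ 2) (ψ : AddChar F ℂ) (hψ : ψ.IsPrimitive) :
    gaussSum (chC F) ψ ≠ 0 :=
  gaussSum_ne_zero_of_nontrivial (by simp) (chC_ne_one hF) hψ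

lemma exists_ext (S : Finset F) (u : S → F) : ∃ v : F → F, ∀ x : S, v x = u x :=
  ⟨fun x => if h : x ∈ S then u ⟨x, h⟩ else 0, fun x => by simp⟩

lemma dual_zero (hF : ringChar F ≠ 2) (S : Finset F) (d : ℕ) (h1 : 1 ≤ #S) (h2 : #S ≤ d) :
    ∑ c : Fin d → F, ∏ x ∈ S, quadraticChar F ((X ^ d + pol c).eval x) = 0 := by
  have hψ := AddChar.FiniteField.primitiveChar_to_Complex_isPrimitive F
  set ψ := AddChar.FiniteField.primitiveChar_to_Complex F
  have key := fourier hF ψ hψ S d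
  have : ∑ c : Fin d → F, ∏ x ∈ S, chC F ((X ^ d + pol c).eval x) = 0 := by
    have h0 : ∑ u : S → F,
        (if (∀ i : Fin d, ∑ x : S, u x * (x : F) ^ (i : ℕ) = 0) then
          (∏ x : S, chC F (u x)) * ψ (∑ x : S, u x * (x : F) ^ d) else 0) = 0 := by
      apply Finset.sum_eq_zero
      intro u _
      split_ifs with h
      · obtain ⟨v, hv⟩ := exists_ext S u
        obtain ⟨Q, hQ, hQ'⟩ := dual_param S d v (fun i hi => by
          rw [← h ⟨i, hi⟩, ← Finset.sum_coe_sort]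
          simp [hv])
        rw [show #S - d = 0 by omega] at hQ
        have hQ0 : Q = 0 := by
          apply degree_eq_bot.mp
          rw [← Nat.WithBot.lt_zero_iff]; exact_mod_cast hQ
        obtain ⟨x, hx⟩ := Finset.card_pos.mp h1
        rw [Finset.prod_eq_zero (Finset.mem_univ ⟨x, hx⟩), zero_mul]
        rw [← hv, hQ' x hx, hQ0, eval_zero, zero_div, MulChar.map_zero]
      · rfl
    rw [h0, mul_zero] at key
    exact (mul_eq_zero.mp key).resolve_left (pow_ne_zero _ (gauss_ne hF ψ hψ))
  simp only [chC_apply] at this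
  exact_mod_cast this

lemma dual_gen (hF : ringChar F ≠ 2) (ψ : AddChar F ℂ) (hψ : ψ.IsPrimitive)
    (S : Finset F) (d m : ℕ) (hS : #S = d + (m + 1)) :
    gaussSum (chC F) ψ ^ #S * ∑ c : Fin d → F, ∏ x ∈ S, chC F ((X ^ d + pol c).eval x)
      = (Fintype.card F : ℂ) ^ d * (∏ x ∈ S, chC F (wt S x)) * ∑ q : Fin (m + 1) → F,
          (∏ x ∈ S, chC F ((pol q).eval x)) * ψ (q (Fin.last m)) := by
  rw [fourier hF ψ hψ S d, mul_assoc]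
  congr 1
  rw [← Finset.sum_filter, Finset.mul_sum]
  symm
  have hlt : ∀ q : Fin (m+1) → F, ∀ i, i ≤ d → (pol q * X ^ i).degree < (#S : WithBot ℕ) := by
    intro q i hi
    by_cases h0 : pol q = 0
    · simp [h0]
    have h := pol_degree q
    rw [degree_eq_natDegree h0] at h
    have : (pol q).natDegree < m + 1 := by exact_mod_cast h
    rw [degree_mul, degree_X_pow, degree_eq_natDegree h0]
    norm_cast; omega
  have hmom : ∀ q : Fin (m+1) → F, ∀ i, i ≤ d →
      ∑ x : S, ((pol q).eval (x : F) / wt S x) * (x : F) ^ i = (pol q * X ^ i).coeff (#S - 1) := by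
    intro q i hi
    rw [← sum_wt S _ (hlt q i hi), ← Finset.sum_coe_sort S]
    apply Finset.sum_congr rfl
    intro x _
    simp only [eval_mul, eval_pow, eval_X]; ring
  apply Finset.sum_bij (fun q _ => fun x : S => (pol q).eval (x : F) / wt S x)
  · intro q _
    simp only [Finset.mem_filter, Finset.mem_univ, true_and]
    intro i
    rw [hmom q i (by omega), coeff_mul_X_pow', if_pos (by omega)]
    apply coeff_eq_zero_of_degree_lt
    apply (pol_degree q).trans_le
    have := i.2
    norm_cast; omega
  · intro a _ b _ hab
    apply pol_injective
    apply eq_of_degrees_lt_of_eval_finset_eq S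
    · exact (pol_degree a).trans_le (by norm_cast; omega)
    · exact (pol_degree b).trans_le (by norm_cast; omega)
    · intro x hx
      have := congrFun hab ⟨x, hx⟩
      simpa [div_left_inj' (wt_ne_zero S x)] using this
  · intro u hu
    simp only [Finset.mem_filter, Finset.mem_univ, true_and] at hu
    obtain ⟨v, hv⟩ := exists_ext S u
    obtain ⟨Q, hQ, hQ'⟩ := dual_param S d v (fun i hi => by
      rw [← hu ⟨i, hi⟩, ← Finset.sum_coe_sort]
      simp [hv])
    rw [show #S - d = m + 1 by omega] at hQ
    obtain ⟨q, hq⟩ := exists_pol Q hQ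
    refine ⟨q, Finset.mem_univ _, ?_⟩
    funext x
    rw [← hv, hQ' x x.2, hq]
  · intro q _
    rw [hmom q d le_rfl, coeff_mul_X_pow', if_pos (by omega),
      show #S - 1 - d = m by omega, ← mul_assoc]
    have := pol_coeff q (Fin.last m)
    rw [Fin.val_last] at this
    rw [this]
    congr 1
    rw [← Finset.prod_mul_distrib, ← Finset.prod_coe_sort S]
    apply Finset.prod_congr rfl
    intro x _
    have hw := wt_ne_zero S (x : F)
    rw [← map_mul, chC_apply, chC_apply]
    congr 1
    rw [show wt S x * (pol q).eval (x : F) = ((pol q).eval (x : F) / wt S x) * wt S x ^ 2 by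
      field_simp, map_mul, quadraticChar_sq_one' hw, mul_one]

lemma chC_wt (S : Finset F) : ∏ x ∈ S, chC F (wt S x) = chC F (-1) ^ (∑ i ∈ range #S, i) := by
  induction S using Finset.induction_on with
  | empty => simp
  | insert z S hz ih =>
    rw [Finset.prod_insert hz, Finset.card_insert_of_notMem hz, Finset.sum_range_succ, pow_add, ← ih]
    have h1 : ∀ x ∈ S, chC F (wt (insert z S) x) = chC F (wt S x) * (chC F (-1) * chC F (z - x)) := by
      intro x hx
      have hxz : z ≠ x := fun h => hz (h ▸ hx)
      rw [← map_mul, ← map_mul]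
      congr 1
      unfold wt
      rw [Finset.erase_insert_of_ne hxz, Finset.prod_insert (fun h => hz (Finset.mem_of_mem_erase h))]
      ring
    rw [Finset.prod_congr rfl h1, Finset.prod_mul_distrib, Finset.prod_mul_distrib, Finset.prod_const]
    have h2 : chC F (wt (insert z S) z) = ∏ x ∈ S, chC F (z - x) := by
      unfold wt
      rw [Finset.erase_insert hz, map_prod]
    rw [h2]
    have h3 : (∏ x ∈ S, chC F (z - x)) * (∏ x ∈ S, chC F (z - x)) = 1 := by
      rw [← Finset.prod_mul_distrib]
      apply Finset.prod_eq_one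
      intro x hx
      have hxz : z - x ≠ 0 := sub_ne_zero.mpr fun h => hz (h ▸ hx)
      rw [chC_apply, ← Int.cast_mul, ← pow_two, quadraticChar_sq_one hxz]; simp
    linear_combination (∏ x ∈ S, chC F (wt S x)) * chC F (-1) ^ #S * h3

end dual

section dual2

variable {F : Type*} [Field F] [Fintype F] [DecidableEq F]

/-- character sum over monic polynomials -/
noncomputable def DS (S : Finset F) (d : ℕ) : ℤ :=
  ∑ c : Fin d → F, ∏ x ∈ S, quadraticChar F ((X ^ d + pol c).eval x)

/-- character sum over polynomials of small degree -/
noncomputable def DT (S : Finset F) (d : ℕ) : ℤ :=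
  ∑ c : Fin d → F, ∏ x ∈ S, quadraticChar F ((pol c).eval x)

lemma pol_snoc {m : ℕ} (c : Fin m → F) (a : F) :
    pol (Fin.snoc c a : Fin (m + 1) → F) = pol c + C a * X ^ m := by
  simp [pol, Fin.sum_univ_castSucc]

lemma pol_smul {m : ℕ} (c : Fin m → F) (a : F) :
    pol (fun i => a * c i) = C a * pol c := by
  simp only [pol, Finset.mul_sum, C_mul]
  apply Finset.sum_congr rfl; intro i _; ring

lemma sum_scale {m : ℕ} {a : F} (ha : a ≠ 0) (f : (Fin m → F) → ℂ) :
    ∑ c : Fin m → F, f (fun i => a * c i) = ∑ c : Fin m → F, f c := by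
  apply Fintype.sum_bijective (fun (c : Fin m → F) => fun i => a * c i)
  · constructor
    · intro c d h
      funext i
      exact mul_left_cancel₀ ha (congrFun h i)
    · intro c
      exact ⟨fun i => a⁻¹ * c i, by funext i; simp [ha]⟩
  · intro c; rfl

lemma T_split (ψ : AddChar F ℂ) (S : Finset F) (hS : 1 ≤ #S) (m : ℕ) :
    ∑ q : Fin (m + 1) → F, (∏ x ∈ S, chC F ((pol q).eval x)) * ψ (q (Fin.last m))
      = (∑ a : F, chC F a ^ #S * ψ a) * (DS S m : ℂ) + (DT S m : ℂ) := by
  have h1 : ∑ q : Fin (m + 1) → F, (∏ x ∈ S, chC F ((pol q).eval x)) * ψ (q (Fin.last m))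
      = ∑ a : F, ∑ c : Fin m → F, (∏ x ∈ S, chC F ((pol c + C a * X ^ m).eval x)) * ψ a := by
    rw [← (Fin.snocEquiv (fun _ => F)).sum_comp, Fintype.sum_prod_type]
    apply Finset.sum_congr rfl; intro a _
    apply Finset.sum_congr rfl; intro c _
    simp [Fin.snocEquiv, pol_snoc]
  rw [h1, ← Finset.add_sum_erase _ _ (Finset.mem_univ (0 : F)),
    ← Finset.add_sum_erase (a := (0 : F)) (f := fun a => chC F a ^ #S * ψ a) _ (Finset.mem_univ (0 : F))]
  have h2 : chC F (0 : F) ^ #S * ψ 0 = 0 := by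
    rw [MulChar.map_zero, zero_pow (by omega), zero_mul]
  rw [h2, zero_add, add_comm]
  congr 1
  · rw [Finset.sum_mul]
    apply Finset.sum_congr rfl
    intro a ha
    have ha0 : a ≠ 0 := (Finset.mem_erase.mp ha).1
    rw [← sum_scale ha0, DS]
    push_cast
    rw [Finset.mul_sum]
    apply Finset.sum_congr rfl
    intro c _
    have : ∏ x ∈ S, chC F ((pol (fun i => a * c i) + C a * X ^ m).eval x)
        = chC F a ^ #S * ∏ x ∈ S, ((quadraticChar F ((X ^ m + pol c).eval x) : ℤ) : ℂ) := by
      rw [← Finset.prod_const, ← Finset.prod_mul_distrib]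
      apply Finset.prod_congr rfl
      intro x _
      rw [← chC_apply, ← map_mul, pol_smul]
      congr 1
      simp only [eval_add, eval_mul, eval_C, eval_pow, eval_X]; ring
    rw [this]; ring
  · rw [DT]
    push_cast
    apply Finset.sum_congr rfl
    intro c _
    simp [chC_apply]

lemma DT_odd (hF : ringChar F ≠ 2) (S : Finset F) (m : ℕ) (h : Odd #S) : DT S m = 0 := by
  obtain ⟨a, ha⟩ := quadraticChar_exists_neg_one hF
  have ha0 : a ≠ 0 := by rintro rfl; simp at ha
  have h1 : (DT S m : ℂ) = - (DT S m : ℂ) := by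
    unfold DT
    push_cast
    conv_lhs => rw [← sum_scale ha0]
    rw [← Finset.sum_neg_distrib]
    apply Finset.sum_congr rfl
    intro c _
    have : ∀ x ∈ S, ((quadraticChar F ((pol (fun i => a * c i)).eval x) : ℤ) : ℂ)
      = (-1) * ((quadraticChar F ((pol c).eval x) : ℤ) : ℂ) := by
      intro x _
      rw [pol_smul, eval_mul, eval_C, map_mul, ha]; push_cast; rfl
    rw [Finset.prod_congr rfl this, Finset.prod_mul_distrib, Finset.prod_const, h.neg_one_pow]
    ring
  have h2 : (DT S m : ℂ) = 0 := by linear_combination h1 / 2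
  exact_mod_cast h2

lemma chC_neg_sq : chC F (-1) ^ 2 = 1 := by
  rw [chC_apply, ← Int.cast_pow, quadraticChar_sq_one (by simp)]; simp

lemma dual_odd (hF : ringChar F ≠ 2) (S : Finset F) (d m h : ℕ) (hS : #S = 2 * h + 1)
    (hd : d + m = 2 * h) :
    (Fintype.card F : ℤ) ^ h * DS S d = (Fintype.card F : ℤ) ^ d * DS S m := by
  have hψ := AddChar.FiniteField.primitiveChar_to_Complex_isPrimitive F
  set ψ := AddChar.FiniteField.primitiveChar_to_Complex F
  have key := dual_gen hF ψ hψ S d m (by omega)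
  rw [T_split ψ S (by omega), DT_odd hF S m ⟨h, hS⟩, chC_wt] at key
  have h1 : ∑ a : F, chC F a ^ #S * ψ a = gaussSum (chC F) ψ := by
    unfold gaussSum
    apply Finset.sum_congr rfl
    intro a _
    congr 1
    rw [hS, pow_succ, pow_mul]
    by_cases ha : a = 0
    · subst ha; simp [MulChar.map_zero]
    · rw [chC_apply, ← Int.cast_pow, quadraticChar_sq_one ha]; simp
  have h2 : (∑ i ∈ range #S, i) = 2 * (h * h) + h := by
    have := Finset.sum_range_id_mul_two #S
    rw [hS, Nat.add_sub_cancel] at this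
    rw [hS]
    nlinarith
  have hg := gaussSum_sq (chC_ne_one hF) chC_quad hψ
  have hg0 := gauss_ne hF ψ hψ
  rw [h1, h2, hS, pow_succ, pow_mul, hg, pow_add, pow_mul, chC_neg_sq, mul_pow] at key
  have hc : chC F (-1) ^ h ≠ 0 := by
    apply pow_ne_zero
    intro h0
    have := chC_neg_sq (F := F)
    rw [h0] at this; norm_num at this
  have key2 : (Fintype.card F : ℂ) ^ h * (DS S d : ℂ) = (Fintype.card F : ℂ) ^ d * (DS S m : ℂ) := by
    apply mul_left_cancel₀ (mul_ne_zero hg0 hc)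
    have e : ∑ c : Fin d → F, ∏ x ∈ S, chC F ((X ^ d + pol c).eval x) = (DS S d : ℂ) := by
      unfold DS; push_cast; rfl
    rw [e] at key
    push_cast at key
    linear_combination key
  exact_mod_cast key2

lemma dual_even (hF : ringChar F ≠ 2) (S : Finset F) (d m h : ℕ) (hS : #S = 2 * h)
    (hd : d + m + 1 = 2 * h) :
    (Fintype.card F : ℤ) ^ h * DS S d = (Fintype.card F : ℤ) ^ d * (DT S m - DS S m) := by
  have hψ := AddChar.FiniteField.primitiveChar_to_Complex_isPrimitive F
  set ψ := AddChar.FiniteField.primitiveChar_to_Complex F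
  have key := dual_gen hF ψ hψ S d m (by omega)
  rw [T_split ψ S (by omega), chC_wt] at key
  have h1 : ∑ a : F, chC F a ^ #S * ψ a = -1 := by
    have h0 : ∑ a : F, ψ a = 0 := by
      have := AddChar.sum_mulShift (1 : F) hψ
      simpa using this
    rw [← Finset.add_sum_erase _ _ (Finset.mem_univ (0 : F))] at h0 ⊢
    rw [MulChar.map_zero, zero_pow (by omega), zero_mul, zero_add]
    rw [AddChar.map_zero_eq_one] at h0
    rw [eq_neg_iff_add_eq_zero, add_comm, ← h0]
    congr 1
    apply Finset.sum_congr rfl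
    intro a ha
    rw [hS, pow_mul, chC_apply, ← Int.cast_pow, quadraticChar_sq_one (Finset.mem_erase.mp ha).1]
    simp
  obtain ⟨h', rfl⟩ : ∃ h', h = h' + 1 := ⟨h - 1, by omega⟩
  have h2 : (∑ i ∈ range #S, i) = 2 * (h' * (h' + 1)) + (h' + 1) := by
    have := Finset.sum_range_id_mul_two #S
    rw [hS, show 2 * (h' + 1) - 1 = 2 * h' + 1 by omega] at this
    rw [hS]
    nlinarith
  have hg := gaussSum_sq (chC_ne_one hF) chC_quad hψ
  rw [h1, h2, hS, pow_mul, hg, pow_add (chC F (-1)), pow_mul (chC F (-1)), chC_neg_sq, mul_pow] at key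
  have hc : chC F (-1) ^ (h' + 1) ≠ 0 := by
    apply pow_ne_zero
    intro h0
    have := chC_neg_sq (F := F)
    rw [h0] at this; norm_num at this
  have key2 : (Fintype.card F : ℂ) ^ (h' + 1) * (DS S d : ℂ)
      = (Fintype.card F : ℂ) ^ d * ((DT S m : ℂ) - (DS S m : ℂ)) := by
    apply mul_left_cancel₀ hc
    have e : ∑ c : Fin d → F, ∏ x ∈ S, chC F ((X ^ d + pol c).eval x) = (DS S d : ℂ) := by
      unfold DS; push_cast; rfl
    rw [e] at key
    linear_combination key
  exact_mod_cast key2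

lemma DS_zero (S : Finset F) : DS S 0 = 1 := by
  simp [DS, pol]

lemma DT_zero (S : Finset F) (h : 1 ≤ #S) : DT S 0 = 0 := by
  have : #S ≠ 0 := by omega
  simp [DT, pol, -quadraticChar_apply, quadraticChar_zero, this]

lemma DT_one (S : Finset F) (h : 1 ≤ #S) (he : Even #S) : DT S 1 = Fintype.card F - 1 := by
  unfold DT
  rw [← (Equiv.funUnique (Fin 1) F).symm.sum_comp]
  simp only [pol_eval]
  simp [-quadraticChar_apply]
  obtain ⟨k, hk⟩ := he
  rw [← Finset.add_sum_erase _ _ (Finset.mem_univ (0 : F))]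
  have : ∀ a ∈ univ.erase (0 : F), quadraticChar F a ^ #S = 1 := by
    intro a ha
    rw [hk, ← two_mul, pow_mul, quadraticChar_sq_one (Finset.mem_erase.mp ha).1, one_pow]
  rw [Finset.sum_congr rfl this, quadraticChar_zero, zero_pow (by omega), zero_add, Finset.sum_const,
    Finset.card_erase_of_mem (Finset.mem_univ _), Finset.card_univ, nsmul_eq_mul, mul_one,
    Nat.cast_sub Fintype.card_pos, Nat.cast_one]

end dual2

section esym

variable {F : Type*} [Field F] [Fintype F] [DecidableEq F]

/-- elementary symmetric function of the values of `f` -/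
def es (a : ℕ) (f : F → ℤ) : ℤ := ∑ S ∈ powersetCard a univ, ∏ x ∈ S, f x

lemma newton (k : ℕ) (f : F → ℤ) :
    (k : ℤ) * es k f = (-1) ^ (k + 1) *
      ∑ i ∈ range k, (-1) ^ i * es i f * ∑ x, f x ^ (k - i) := by
  have h := congrArg (MvPolynomial.aeval f) (MvPolynomial.mul_esymm_eq_sum F ℤ k)
  have he : ∀ i, (MvPolynomial.aeval f) (MvPolynomial.esymm F ℤ i) = es i f := by
    intro i
    simp [MvPolynomial.esymm, es]
  have hp : ∀ i, (MvPolynomial.aeval f) (MvPolynomial.psum F ℤ i) = ∑ x, f x ^ i := by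
    intro i
    simp [MvPolynomial.psum]
  simp only [map_mul, map_sum, map_pow, map_neg, map_one, map_natCast, he, hp] at h
  rw [h, Finset.sum_filter, Finset.Nat.sum_antidiagonal_eq_sum_range_succ_mk, Finset.sum_range_succ]
  simp only [lt_self_iff_false, if_false, add_zero]
  congr 1
  apply Finset.sum_congr rfl
  intro i hi
  rw [if_pos (Finset.mem_range.mp hi)]

/-- Krawtchouk type polynomials -/
def K : ℕ → ℤ → ℤ → ℤ
  | 0, _, _ => 1
  | 1, s, _ => s
  | (n + 2), s, N => s * K (n + 1) s N - (n + 1) * (N - n) * K n s N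

lemma es_K (f : F → ℤ) (hf : ∀ x, f x ^ 3 = f x) (a : ℕ) (ha : a ≤ 7) :
    (a.factorial : ℤ) * es a f = K a (∑ x, f x) (∑ x, f x ^ 2) := by
  have h3 : ∀ x, f x ^ 3 = f x := hf
  have h4 : ∀ x, f x ^ 4 = f x ^ 2 := fun x => by rw [pow_succ, hf]; ring
  have h5 : ∀ x, f x ^ 5 = f x := fun x => by rw [pow_succ, h4, ← pow_succ, hf]
  have h6 : ∀ x, f x ^ 6 = f x ^ 2 := fun x => by rw [pow_succ, h5]; ring
  have h7 : ∀ x, f x ^ 7 = f x := fun x => by rw [pow_succ, h6, ← pow_succ, hf]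
  have e0 : es 0 f = 1 := by simp [es]
  have e1 := newton 1 f
  have e2 := newton 2 f
  have e3 := newton 3 f
  have e4 := newton 4 f
  have e5 := newton 5 f
  have e6 := newton 6 f
  have e7 := newton 7 f
  simp [Finset.sum_range_succ, e0, h3, h4, h5, h6, h7] at e1 e2 e3 e4 e5 e6 e7
  generalize ∑ x, f x = s at *
  generalize ∑ x, f x ^ 2 = N at *
  have r2 : 2 * es 2 f = s * s - N := by rw [e2, e1]; ring
  have r3 : 3 * es 3 f = s * es 2 f - (N - 1) * s := by rw [e3, e1]; ring
  have r4 : 4 * es 4 f = s * es 3 f - (N - 2) * es 2 f := by linear_combination e4 - e2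
  have r5 : 5 * es 5 f = s * es 4 f - (N - 3) * es 3 f := by linear_combination e5 - e3
  have r6 : 6 * es 6 f = s * es 5 f - (N - 4) * es 4 f := by linear_combination e6 - e4
  have r7 : 7 * es 7 f = s * es 6 f - (N - 5) * es 5 f := by linear_combination e7 - e5
  have k2 : 2 * es 2 f = K 2 s N := by rw [r2]; simp [K]
  have k3 : 6 * es 3 f = K 3 s N := by
    rw [K, ← k2, K]; push_cast; linear_combination 2 * r3
  have k4 : 24 * es 4 f = K 4 s N := by
    rw [K, ← k3, ← k2]; push_cast; linear_combination 6 * r4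
  have k5 : 120 * es 5 f = K 5 s N := by
    rw [K, ← k4, ← k3]; push_cast; linear_combination 24 * r5
  have k6 : 720 * es 6 f = K 6 s N := by
    rw [K, ← k5, ← k4]; push_cast; linear_combination 120 * r6
  have k7 : 5040 * es 7 f = K 7 s N := by
    rw [K, ← k6, ← k5]; push_cast; linear_combination 720 * r7
  interval_cases a
  · simp [e0, K]
  · simp [e1, K]
  · simpa using k2
  · simpa [Nat.factorial] using k3
  · simpa [Nat.factorial] using k4
  · simpa [Nat.factorial] using k5
  · simpa [Nat.factorial] using k6
  · simpa [Nat.factorial] using k7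

lemma chi_cube (a : F) : quadraticChar F a ^ 3 = quadraticChar F a := by
  by_cases h : a = 0
  · subst h; simp
  · rw [pow_succ, quadraticChar_sq_one h, one_mul]

end esym

section mon

variable {F : Type*} [Field F] [Fintype F] [DecidableEq F]

/-- monic polynomials of degree d -/
noncomputable def mon (F : Type*) [Field F] [Fintype F] [DecidableEq F] (d : ℕ) : Finset F[X] :=
  univ.image (fun c : Fin d → F => X ^ d + pol c)

lemma mem_mon (d : ℕ) (D : F[X]) : D ∈ mon F d ↔ D.Monic ∧ D.natDegree = d := by
  unfold mon
  simp only [Finset.mem_image, Finset.mem_univ, true_and]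
  constructor
  · rintro ⟨c, rfl⟩
    have h := pol_degree c
    refine ⟨monic_X_pow_add h, ?_⟩
    have : (X ^ d + pol c).degree = (d : WithBot ℕ) := by
      rw [degree_add_eq_left_of_degree_lt (by rwa [degree_X_pow]), degree_X_pow]
    exact natDegree_eq_of_degree_eq_some this
  · rintro ⟨h1, rfl⟩
    obtain ⟨c, hc⟩ := exists_pol (d := D.natDegree) (D - X ^ D.natDegree) (by
      rw [← degree_eq_natDegree h1.ne_zero]
      apply degree_sub_lt_left
      · rw [degree_X_pow, degree_eq_natDegree h1.ne_zero]
      · exact h1.ne_zero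
      · rw [h1.leadingCoeff, leadingCoeff_X_pow])
    exact ⟨c, by rw [hc]; ring⟩

lemma sum_mon {M : Type*} [AddCommMonoid M] (d : ℕ) (Φ : F[X] → M) :
    ∑ D ∈ mon F d, Φ D = ∑ c : Fin d → F, Φ (X ^ d + pol c) := by
  unfold mon
  rw [Finset.sum_image]
  intro a _ b _ h
  exact pol_injective (add_left_cancel h)

lemma card_mon (d : ℕ) : (#(mon F d) : ℤ) = (Fintype.card F : ℤ) ^ d := by
  have := sum_mon (F := F) d (fun _ => (1 : ℤ))
  simpa using this

/-- values of the character along a polynomial -/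
noncomputable def chi (D : F[X]) (x : F) : ℤ := quadraticChar F (D.eval x)

lemma chi_mul (A B : F[X]) (x : F) : chi (A * B) x = chi A x * chi B x := by
  simp only [chi, eval_mul, map_mul]

/-- number of roots -/
noncomputable def rr (D : F[X]) : ℤ := ∑ y : F, if D.eval y = 0 then 1 else 0

lemma sum_chi_sq (D : F[X]) : ∑ x, chi D x ^ 2 = Fintype.card F - rr D := by
  unfold rr chi
  rw [eq_sub_iff_add_eq, ← Finset.sum_add_distrib]
  rw [Finset.sum_congr rfl (g := fun _ => (1 : ℤ))]
  · simp
  · intro x _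
    split_ifs with h
    · rw [h]; simp
    · rw [quadraticChar_sq_one h]; simp

lemma es_chi (D : F[X]) (a : ℕ) (ha : a ≤ 7) :
    (a.factorial : ℤ) * es a (chi D) = K a (∑ x, chi D x) (Fintype.card F - rr D) := by
  rw [es_K (chi D) (fun x => chi_cube _) a ha, sum_chi_sq]

lemma root_one (d : ℕ) (y : F) (Φ : F[X] → ℤ) :
    ∑ D ∈ mon F (d + 1), (if D.eval y = 0 then Φ D else 0) = ∑ c ∈ mon F d, Φ ((X - C y) * c) := by
  rw [← Finset.sum_filter]
  symm
  apply Finset.sum_bij (fun c _ => (X - C y) * c)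
  · intro c hc
    rw [mem_mon] at hc
    rw [Finset.mem_filter, mem_mon]
    refine ⟨⟨(monic_X_sub_C y).mul hc.1, ?_⟩, by simp⟩
    rw [(monic_X_sub_C y).natDegree_mul hc.1, natDegree_X_sub_C, hc.2, add_comm]
  · intro a _ b _ h
    exact mul_left_cancel₀ (X_sub_C_ne_zero y) h
  · intro D hD
    rw [Finset.mem_filter, mem_mon] at hD
    obtain ⟨c, rfl⟩ := dvd_iff_isRoot.mpr hD.2
    have hc : c.Monic := (monic_X_sub_C y).of_mul_monic_left hD.1.1
    refine ⟨c, ?_, rfl⟩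
    rw [mem_mon]
    refine ⟨hc, ?_⟩
    have := hD.1.2
    rw [(monic_X_sub_C y).natDegree_mul hc, natDegree_X_sub_C] at this
    omega
  · intro c _; rfl

lemma root_off (d : ℕ) (T : Finset F) (Φ : F[X] → ℤ) :
    ∑ D ∈ mon F (d + 1), (∑ y ∈ T, if D.eval y = 0 then 1 else 0) * Φ D
      = ∑ y ∈ T, ∑ c ∈ mon F d, Φ ((X - C y) * c) := by
  simp_rw [Finset.sum_mul]
  rw [Finset.sum_comm]
  apply Finset.sum_congr rfl
  intro y _
  rw [← root_one]
  apply Finset.sum_congr rfl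
  intro D _
  split_ifs <;> simp

lemma root1 (d : ℕ) (Φ : F[X] → ℤ) :
    ∑ D ∈ mon F (d + 1), rr D * Φ D = ∑ y, ∑ c ∈ mon F d, Φ ((X - C y) * c) :=
  root_off d univ Φ

lemma rr_one (y : F) (c : F[X]) :
    rr ((X - C y) * c) - 1 = ∑ z ∈ univ.erase y, if c.eval z = 0 then 1 else 0 := by
  unfold rr
  rw [← Finset.add_sum_erase _ _ (Finset.mem_univ y)]
  simp only [eval_mul, eval_sub, eval_X, eval_C, sub_self, zero_mul, if_true, add_sub_cancel_left]
  apply Finset.sum_congr rfl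
  intro z hz
  have : z - y ≠ 0 := sub_ne_zero.mpr (Finset.mem_erase.mp hz).1
  simp [this]

lemma root2 (d : ℕ) (Φ : F[X] → ℤ) :
    ∑ D ∈ mon F (d + 2), rr D * (rr D - 1) * Φ D
      = ∑ y, ∑ z ∈ univ.erase y, ∑ c ∈ mon F d, Φ ((X - C y) * ((X - C z) * c)) := by
  simp_rw [mul_assoc]
  rw [root1 (d + 1) (fun D => (rr D - 1) * Φ D)]
  apply Finset.sum_congr rfl
  intro y _
  simp_rw [rr_one]
  exact root_off d (univ.erase y) (fun c => Φ ((X - C y) * c))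

lemma rr_two (y z : F) (hyz : z ∈ univ.erase y) (c : F[X]) :
    rr ((X - C y) * ((X - C z) * c)) - 2
      = ∑ t ∈ (univ.erase y).erase z, if c.eval t = 0 then 1 else 0 := by
  have h := rr_one y ((X - C z) * c)
  have h2 : rr ((X - C y) * ((X - C z) * c)) - 2 = (rr ((X - C y) * ((X - C z) * c)) - 1) - 1 := by ring
  rw [h2, h, ← Finset.add_sum_erase _ _ hyz]
  simp only [eval_mul, eval_sub, eval_X, eval_C, sub_self, zero_mul, if_true, add_sub_cancel_left]
  apply Finset.sum_congr rfl
  intro t ht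
  have : t - z ≠ 0 := sub_ne_zero.mpr (Finset.mem_erase.mp ht).1
  simp [this]

lemma root3 (d : ℕ) (Φ : F[X] → ℤ) :
    ∑ D ∈ mon F (d + 3), rr D * (rr D - 1) * (rr D - 2) * Φ D
      = ∑ y, ∑ z ∈ univ.erase y, ∑ t ∈ (univ.erase y).erase z, ∑ c ∈ mon F d,
          Φ ((X - C y) * ((X - C z) * ((X - C t) * c))) := by
  have := root2 (d + 1) (fun D => (rr D - 2) * Φ D)
  simp_rw [← mul_assoc] at this
  simp_rw [← mul_assoc]
  rw [this]
  apply Finset.sum_congr rfl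
  intro y _
  apply Finset.sum_congr rfl
  intro z hz
  have h2 := root_off d ((univ.erase y).erase z) (fun c => Φ ((X - C y) * ((X - C z) * c)))
  simp_rw [← rr_two y z hz, ← mul_assoc] at h2
  exact h2

/-! weighted sums -/

lemma es_mul_sum (d a : ℕ) (w : F[X]) :
    ∑ c ∈ mon F d, es a (chi (w * c)) = ∑ S ∈ powersetCard a univ, (∏ x ∈ S, chi w x) * DS S d := by
  unfold es
  rw [Finset.sum_comm]
  apply Finset.sum_congr rfl
  intro S _
  simp_rw [chi_mul, Finset.prod_mul_distrib]
  rw [← Finset.mul_sum, DS, sum_mon]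
  rfl

lemma V_zero (hF : ringChar F ≠ 2) (d a : ℕ) (w : F[X]) (h1 : 1 ≤ a) (h2 : a ≤ d) :
    ∑ c ∈ mon F d, es a (chi (w * c)) = 0 := by
  rw [es_mul_sum]
  apply Finset.sum_eq_zero
  intro S hS
  have hS := (Finset.mem_powersetCard.mp hS).2
  have : DS S d = 0 := dual_zero hF S d (by omega) (by omega)
  rw [this, mul_zero]

lemma V_odd (hF : ringChar F ≠ 2) (d m h : ℕ) (w : F[X]) (hd : d + m = 2 * h) :
    (Fintype.card F : ℤ) ^ h * ∑ c ∈ mon F d, es (2 * h + 1) (chi (w * c))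
      = (Fintype.card F : ℤ) ^ d * ∑ c ∈ mon F m, es (2 * h + 1) (chi (w * c)) := by
  rw [es_mul_sum, es_mul_sum, Finset.mul_sum, Finset.mul_sum]
  apply Finset.sum_congr rfl
  intro S hS
  have := dual_odd hF S d m h (Finset.mem_powersetCard.mp hS).2 hd
  linear_combination (∏ x ∈ S, chi w x) * this

lemma V_even (hF : ringChar F ≠ 2) (d m h : ℕ) (w : F[X]) (hd : d + m + 1 = 2 * h) (t : ℤ)
    (ht : ∀ S : Finset F, #S = 2 * h → DT S m = t) :
    (Fintype.card F : ℤ) ^ h * ∑ c ∈ mon F d, es (2 * h) (chi (w * c))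
      = (Fintype.card F : ℤ) ^ d * (t * es (2 * h) (chi w)
          - ∑ c ∈ mon F m, es (2 * h) (chi (w * c))) := by
  rw [es_mul_sum, es_mul_sum, es, Finset.mul_sum, Finset.mul_sum, ← Finset.sum_sub_distrib, Finset.mul_sum]
  apply Finset.sum_congr rfl
  intro S hS
  have hS := (Finset.mem_powersetCard.mp hS).2
  have := dual_even hF S d m h hS hd
  rw [ht S hS] at this
  linear_combination (∏ x ∈ S, chi w x) * this

end mon

section quad

variable {F : Type*} [Field F] [Fintype F] [DecidableEq F]

lemma card_sq (hF : ringChar F ≠ 2) (a : F) :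
    ∑ x : F, (if x ^ 2 = a then (1 : ℤ) else 0) = quadraticChar F a + 1 := by
  rw [← quadraticChar_card_sqrts hF a]
  simp [Set.toFinset_ofPred]

lemma sum_sq (hF : ringChar F ≠ 2) (f : F → ℤ) :
    ∑ x : F, f (x ^ 2) = ∑ t, (quadraticChar F t + 1) * f t := by
  simp_rw [← card_sq hF, Finset.sum_mul]
  rw [Finset.sum_comm]
  apply Finset.sum_congr rfl
  intro x _
  simp

lemma sum_shift (f : F → ℤ) (a : F) : ∑ x, f (x + a) = ∑ x, f x :=
  Equiv.sum_comp (Equiv.addRight a) f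

lemma sum_aff (hF : ringChar F ≠ 2) (a b : F) (ha : a ≠ 0) : ∑ x : F, quadraticChar F (a * x + b) = 0 := by
  rw [← quadraticChar_sum_zero hF]
  exact ((Equiv.mulLeft₀ a ha).trans (Equiv.addRight b)).sum_comp (fun x => quadraticChar F x)

lemma sum_two (hF : ringChar F ≠ 2) (a : F) (ha : a ≠ 0) :
    ∑ t, quadraticChar F (t * (t - a)) = -1 := by
  have h0 := sum_aff hF (-a) 1 (neg_ne_zero.mpr ha)
  rw [← Finset.add_sum_erase _ _ (Finset.mem_univ (0 : F))] at h0 ⊢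
  have : ∑ x ∈ univ.erase (0 : F), quadraticChar F (x * (x - a))
      = ∑ x ∈ univ.erase (0 : F), quadraticChar F (-a * x + 1) := by
    refine Finset.sum_bij' (fun x _ => x⁻¹) (fun x _ => x⁻¹) ?_ ?_ ?_ ?_ ?_
    · intro x hx
      simpa only [Finset.mem_erase, Finset.mem_univ, and_true, ne_eq, inv_eq_zero] using hx
    · intro x hx
      simpa only [Finset.mem_erase, Finset.mem_univ, and_true, ne_eq, inv_eq_zero] using hx
    · intro x hx; exact inv_inv x
    · intro x hx; exact inv_inv x
    · intro x hx
      have hx0 : x ≠ 0 := by simpa using hx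
      have : x * (x - a) = x ^ 2 * (-a * x⁻¹ + 1) := by field_simp; ring
      rw [this, map_mul, quadraticChar_sq_one' hx0, one_mul]
  rw [this]
  simp only [mul_zero, zero_add, map_one] at h0
  simp only [zero_mul, quadraticChar_zero]
  linarith

lemma sum_quad (hF : ringChar F ≠ 2) (a : F) (ha : a ≠ 0) :
    ∑ x : F, quadraticChar F (x ^ 2 - a) = -1 := by
  rw [sum_sq hF (fun t => quadraticChar F (t - a))]
  simp_rw [add_mul, ← map_mul, one_mul]
  rw [Finset.sum_add_distrib, sum_two hF a ha]
  have := sum_aff hF 1 (-a) one_ne_zero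
  simp only [one_mul, ← sub_eq_add_neg] at this
  rw [this]; simp

lemma two_ne (hF : ringChar F ≠ 2) : (2 : F) ≠ 0 := Ring.two_ne_zero hF

/-- shifted form of quadratic polynomials -/
lemma sum_mon_two (hF : ringChar F ≠ 2) (Φ : F[X] → ℤ) :
    ∑ c ∈ mon F 2, Φ c = ∑ b : F, ∑ δ : F, Φ ((X + C b) ^ 2 - C δ) := by
  have h2 := two_ne hF
  rw [← Fintype.sum_prod_type' (f := fun b δ => Φ ((X + C b) ^ 2 - C δ)), sum_mon]
  symm
  apply Fintype.sum_bijective (fun z : F × F => ![z.1 ^ 2 - z.2, 2 * z.1])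
  · constructor
    · rintro ⟨a, b⟩ ⟨c, d⟩ h
      have h0 := congrFun h 0
      have h1 := congrFun h 1
      simp at h0 h1
      rcases h1 with h1 | h1
      · subst h1; simpa using h0
      · exact absurd h1 h2
    · intro c
      refine ⟨(c 1 / 2, (c 1 / 2) ^ 2 - c 0), ?_⟩
      funext i
      fin_cases i
      · simp
      · simp; field_simp
  · rintro ⟨b, δ⟩
    congr 1
    have hC : (C (2 : F)) = 2 := rfl
    simp [pol, Fin.sum_univ_two, hC]
    ring

lemma chi_quad (hF : ringChar F ≠ 2) (b δ : F) :
    ∑ x, chi ((X + C b) ^ 2 - C δ) x = if δ = 0 then (Fintype.card F : ℤ) - 1 else -1 := by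
  unfold chi
  simp only [eval_sub, eval_pow, eval_add, eval_X, eval_C]
  rw [sum_shift (fun x => quadraticChar F (x ^ 2 - δ)) b]
  split_ifs with h
  · subst h
    simp only [sub_zero]
    rw [← Finset.add_sum_erase _ _ (Finset.mem_univ (0 : F)),
      Finset.sum_congr rfl (fun x hx => quadraticChar_sq_one' (Finset.mem_erase.mp hx).1)]
    rw [Finset.sum_const, Finset.card_erase_of_mem (Finset.mem_univ _), Finset.card_univ, nsmul_eq_mul,
      mul_one, Nat.cast_sub Fintype.card_pos]
    simp
  · exact sum_quad hF δ h

lemma rr_quad (hF : ringChar F ≠ 2) (b δ : F) :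
    rr ((X + C b) ^ 2 - C δ) = quadraticChar F δ + 1 := by
  unfold rr
  simp only [eval_sub, eval_pow, eval_add, eval_X, eval_C, sub_eq_zero]
  rw [sum_shift (fun x => if x ^ 2 = δ then (1 : ℤ) else 0) b, card_sq hF]

/-- summing functions of the character -/
lemma sum_fun_chi (hF : ringChar F ≠ 2) (φ : ℤ → ℤ) :
    2 * ∑ δ : F, φ (quadraticChar F δ)
      = 2 * φ 0 + ((Fintype.card F : ℤ) - 1) * (φ 1 + φ (-1)) := by
  have h : ∀ δ : F, 2 * φ (quadraticChar F δ) = 2 * φ 0 + (φ 1 - φ (-1)) * quadraticChar F δ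
      + (φ 1 + φ (-1) - 2 * φ 0) * quadraticChar F δ ^ 2 := by
    intro δ
    by_cases h : δ = 0
    · subst h; simp
    · rcases quadraticChar_dichotomy h with h | h <;> rw [h] <;> ring
  rw [Finset.mul_sum, Finset.sum_congr rfl (fun δ _ => h δ), Finset.sum_add_distrib,
    Finset.sum_add_distrib, ← Finset.mul_sum, ← Finset.mul_sum, ← Finset.mul_sum, quadraticChar_sum_zero hF]
  have h2 : ∑ δ : F, quadraticChar F δ ^ 2 = Fintype.card F - 1 := by
    rw [← Finset.add_sum_erase _ _ (Finset.mem_univ (0 : F)),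
      Finset.sum_congr rfl (fun x hx => quadraticChar_sq_one (Finset.mem_erase.mp hx).1)]
    rw [Finset.sum_const, Finset.card_erase_of_mem (Finset.mem_univ _), Finset.card_univ, nsmul_eq_mul,
      mul_one, Nat.cast_sub Fintype.card_pos]
    simp
  rw [h2, Finset.sum_const, Finset.card_univ, nsmul_eq_mul]
  ring

end quad

section tot

variable {F : Type*} [Field F] [Fintype F] [DecidableEq F]

/-- scaled elementary symmetric function of a polynomial -/
noncomputable def sK (a : ℕ) (D : F[X]) : ℤ := K a (∑ x, chi D x) (Fintype.card F - rr D)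

lemma sK_es (a : ℕ) (ha : a ≤ 7) (D : F[X]) : sK a D = (a.factorial : ℤ) * es a (chi D) :=
  (es_chi D a ha).symm

/-- falling factorial -/
def ff : ℕ → ℤ → ℤ
  | 0, _ => 1
  | (n + 1), r => ff n r * (r - n)

/-- weighted total -/
noncomputable def Wf (F : Type*) [Field F] [Fintype F] [DecidableEq F] (a b : ℕ) : ℤ :=
  ∑ D ∈ mon F 4, sK a D * ff b (rr D)

lemma sK_zero_sum (hF : ringChar F ≠ 2) (d a : ℕ) (w : F[X]) (h1 : 1 ≤ a) (h2 : a ≤ d) (h3 : a ≤ 7) :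
    ∑ c ∈ mon F d, sK a (w * c) = 0 := by
  simp_rw [sK_es a h3]
  rw [← Finset.mul_sum, V_zero hF d a w h1 h2, mul_zero]

lemma sK_odd_sum (hF : ringChar F ≠ 2) (d m h : ℕ) (w : F[X]) (hd : d + m = 2 * h) (h3 : 2 * h + 1 ≤ 7) :
    (Fintype.card F : ℤ) ^ h * ∑ c ∈ mon F d, sK (2 * h + 1) (w * c)
      = (Fintype.card F : ℤ) ^ d * ∑ c ∈ mon F m, sK (2 * h + 1) (w * c) := by
  simp_rw [sK_es (2 * h + 1) h3]
  rw [← Finset.mul_sum, ← Finset.mul_sum]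
  linear_combination ((2 * h + 1).factorial : ℤ) * V_odd hF d m h w hd

lemma sK_even_sum (hF : ringChar F ≠ 2) (d m h : ℕ) (w : F[X]) (hd : d + m + 1 = 2 * h) (t : ℤ)
    (ht : ∀ S : Finset F, #S = 2 * h → DT S m = t) (h3 : 2 * h ≤ 7) :
    (Fintype.card F : ℤ) ^ h * ∑ c ∈ mon F d, sK (2 * h) (w * c)
      = (Fintype.card F : ℤ) ^ d * (t * sK (2 * h) w - ∑ c ∈ mon F m, sK (2 * h) (w * c)) := by
  simp_rw [sK_es (2 * h) h3]
  rw [← Finset.mul_sum, ← Finset.mul_sum]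
  linear_combination ((2 * h).factorial : ℤ) * V_even hF d m h w hd t ht

lemma mon_zero : mon F 0 = {1} := by
  ext D
  rw [mem_mon, Finset.mem_singleton]
  constructor
  · rintro ⟨h1, h2⟩; exact h1.natDegree_eq_zero.mp h2
  · rintro rfl; exact ⟨monic_one, natDegree_one⟩

lemma sum_mon_one (Φ : F[X] → ℤ) : ∑ c ∈ mon F 1, Φ c = ∑ z : F, Φ (X - C z) := by
  rw [sum_mon]
  symm
  apply Fintype.sum_bijective (fun z : F => ![-z])
  · constructor
    · intro a b h
      have h0 := congrFun h 0
      simpa using h0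
    · intro c
      refine ⟨-c 0, ?_⟩
      funext i
      fin_cases i
      simp
  · intro b
    congr 1
    simp [pol, sub_eq_add_neg]

lemma card_pos' : (0 : ℤ) < Fintype.card F := by exact_mod_cast Fintype.card_pos

lemma sK_val (a : ℕ) (D : F[X]) (s r : ℤ) (hs : ∑ x, chi D x = s) (hr : rr D = r) :
    sK a D = K a s (Fintype.card F - r) := by rw [sK, hs, hr]

lemma sK_one (a : ℕ) : sK a (1 : F[X]) = K a (Fintype.card F) (Fintype.card F) := by
  rw [sK_val a 1 (Fintype.card F) 0, sub_zero]
  · simp [chi, -quadraticChar_apply]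
  · simp [rr]

lemma sK_lin (hF : ringChar F ≠ 2) (a : ℕ) (y : F) :
    sK a (X - C y) = K a 0 ((Fintype.card F : ℤ) - 1) := by
  apply sK_val
  · have := sum_aff hF 1 (-y) one_ne_zero
    simpa [chi, -quadraticChar_apply, sub_eq_add_neg] using this
  · simp [rr, sub_eq_zero]

lemma sK_lin2 (hF : ringChar F ≠ 2) (a : ℕ) (y z : F) (h : z ≠ y) :
    sK a ((X - C y) * (X - C z)) = K a (-1) ((Fintype.card F : ℤ) - 2) := by
  apply sK_val
  · have := sum_two hF (z - y) (sub_ne_zero.mpr h)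
    rw [← sum_shift _ (-y)] at this
    rw [← this]
    apply Finset.sum_congr rfl
    intro x _
    simp only [chi, eval_mul, eval_sub, eval_X, eval_C]
    congr 1
    ring
  · have := rr_one y (X - C z)
    have h2 : ∑ t ∈ univ.erase y, (if (X - C z).eval t = 0 then (1 : ℤ) else 0) = 1 := by
      rw [Finset.sum_eq_single_of_mem z]
      · simp
      · simp [h]
      · intro b _ hb
        simp [sub_eq_zero, hb]
    rw [h2] at this
    linarith

lemma sK_lin3 (hF : ringChar F ≠ 2) (a : ℕ) (y : F) :
    sK a ((X - C y) * (X - C y)) = K a ((Fintype.card F : ℤ) - 1) ((Fintype.card F : ℤ) - 1) := by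
  have h : (X - C y) * (X - C y) = (X + C (-y)) ^ 2 - C (0 : F) := by
    simp only [C_neg, C_0]; ring
  rw [h]
  apply sK_val
  · rw [chi_quad hF]; simp
  · rw [rr_quad hF]; simp

lemma W0 (a : ℕ) : Wf F a 0 = ∑ c ∈ mon F 4, sK a (1 * c) := by simp [Wf, ff]

lemma W1 (a : ℕ) : Wf F a 1 = ∑ y : F, ∑ c ∈ mon F 3, sK a ((X - C y) * c) := by
  rw [← root1 3 (fun D => sK a D)]
  apply Finset.sum_congr rfl; intro D _; simp [ff]; ring

lemma W2 (a : ℕ) : Wf F a 2 = ∑ y : F, ∑ z ∈ univ.erase y, ∑ c ∈ mon F 2, sK a ((X - C y) * (X - C z) * c) := by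
  simp_rw [mul_assoc]
  rw [← root2 2 (fun D => sK a D)]
  apply Finset.sum_congr rfl; intro D _; simp [ff]; ring

lemma W3 (a : ℕ) : Wf F a 3 = ∑ y : F, ∑ z ∈ univ.erase y, ∑ t ∈ (univ.erase y).erase z,
    ∑ c ∈ mon F 1, sK a ((X - C y) * (X - C z) * (X - C t) * c) := by
  simp_rw [mul_assoc]
  rw [← root3 1 (fun D => sK a D)]
  apply Finset.sum_congr rfl; intro D _; simp [ff]; ring

lemma W0z (hF : ringChar F ≠ 2) (a : ℕ) (h1 : 1 ≤ a) (h2 : a ≤ 4) : Wf F a 0 = 0 := by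
  rw [W0, sK_zero_sum hF 4 a 1 h1 h2 (by omega)]

lemma W1z (hF : ringChar F ≠ 2) (a : ℕ) (h1 : 1 ≤ a) (h2 : a ≤ 3) : Wf F a 1 = 0 := by
  rw [W1]
  exact Finset.sum_eq_zero fun y _ => sK_zero_sum hF 3 a _ h1 h2 (by omega)

lemma W2z (hF : ringChar F ≠ 2) (a : ℕ) (h1 : 1 ≤ a) (h2 : a ≤ 2) : Wf F a 2 = 0 := by
  rw [W2]
  exact Finset.sum_eq_zero fun y _ => Finset.sum_eq_zero fun z _ =>
    sK_zero_sum hF 2 a _ h1 h2 (by omega)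

lemma W3z (hF : ringChar F ≠ 2) (a : ℕ) (h1 : 1 ≤ a) (h2 : a ≤ 1) : Wf F a 3 = 0 := by
  rw [W3]
  exact Finset.sum_eq_zero fun y _ => Finset.sum_eq_zero fun z _ => Finset.sum_eq_zero fun t _ =>
    sK_zero_sum hF 1 a _ h1 h2 (by omega)

lemma card_er (y : F) : (#(univ.erase y) : ℤ) = (Fintype.card F : ℤ) - 1 := by
  rw [Finset.card_erase_of_mem (Finset.mem_univ _), Finset.card_univ, Nat.cast_sub Fintype.card_pos]
  simp

lemma card_er2 (y z : F) (h : z ∈ univ.erase y) :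
    (#((univ.erase y).erase z) : ℤ) = (Fintype.card F : ℤ) - 2 := by
  rw [Finset.card_erase_of_mem h, Nat.cast_sub (Finset.card_pos.mpr ⟨z, h⟩), card_er]
  push_cast; ring

lemma W00 : Wf F 0 0 = (Fintype.card F : ℤ) ^ 4 := by
  rw [W0]; simp [sK, K, card_mon]

lemma W01 : Wf F 0 1 = (Fintype.card F : ℤ) ^ 4 := by
  rw [W1]; simp [sK, K, card_mon]; ring

lemma W02 : Wf F 0 2 = (Fintype.card F : ℤ) ^ 3 * ((Fintype.card F : ℤ) - 1) := by
  rw [W2]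
  simp only [sK, K, Finset.sum_const, nsmul_eq_mul, card_mon, card_er, mul_one, Finset.card_univ]
  ring

lemma W03 : Wf F 0 3 = (Fintype.card F : ℤ) ^ 2 * ((Fintype.card F : ℤ) - 1) * ((Fintype.card F : ℤ) - 2) := by
  rw [W3]
  simp only [sK, K, Finset.sum_const, nsmul_eq_mul, card_mon, mul_one, Finset.card_univ]
  rw [Finset.sum_congr rfl (fun y _ => Finset.sum_congr rfl (fun z hz => by rw [card_er2 y z hz]))]
  simp only [Finset.sum_const, nsmul_eq_mul, card_er, Finset.card_univ]
  ring

lemma W50 (hF : ringChar F ≠ 2) : Wf F 5 0 = (Fintype.card F : ℤ) ^ 2 * K 5 (Fintype.card F) (Fintype.card F) := by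
  have h := sK_odd_sum hF 4 0 2 1 rfl (by norm_num)
  norm_num only at h
  rw [← W0, mon_zero, Finset.sum_singleton, mul_one, sK_one] at h
  have hq := (card_pos' (F := F)).ne'
  apply mul_left_cancel₀ (pow_ne_zero 2 hq)
  rw [h]; ring

lemma W60 (hF : ringChar F ≠ 2) : Wf F 6 0 = (Fintype.card F : ℤ) *
    (((Fintype.card F : ℤ) - 1) * K 6 (Fintype.card F) (Fintype.card F)
      - (Fintype.card F : ℤ) * K 6 0 ((Fintype.card F : ℤ) - 1)) := by
  have h := sK_even_sum hF 4 1 3 1 rfl ((Fintype.card F : ℤ) - 1)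
    (fun S hS => DT_one S (by omega) ⟨3, by omega⟩) (by norm_num)
  norm_num only at h
  rw [← W0] at h
  simp only [one_mul] at h
  rw [sum_mon_one, sK_one, Finset.sum_congr rfl (fun z _ => sK_lin hF 6 z)] at h
  simp only [Finset.sum_const, nsmul_eq_mul, Finset.card_univ] at h
  have hq := (card_pos' (F := F)).ne'
  apply mul_left_cancel₀ (pow_ne_zero 3 hq)
  rw [h]; ring

lemma W70 (hF : ringChar F ≠ 2) : 2 * Wf F 7 0 = (Fintype.card F : ℤ) ^ 2 *
    (((Fintype.card F : ℤ) - 1) * (K 7 (-1) (Fintype.card F) + K 7 (-1) ((Fintype.card F : ℤ) - 2))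
      + 2 * K 7 ((Fintype.card F : ℤ) - 1) ((Fintype.card F : ℤ) - 1)) := by
  have h := sK_odd_sum hF 4 2 3 1 rfl (by norm_num)
  norm_num only at h
  rw [← W0] at h
  simp only [one_mul] at h
  have hq := (card_pos' (F := F)).ne'
  have h2 : ∀ b δ : F, sK 7 ((X + C b) ^ 2 - C δ) =
      K 7 (-1) ((Fintype.card F : ℤ) - (quadraticChar F δ + 1))
      + if δ = 0 then K 7 ((Fintype.card F : ℤ) - 1) ((Fintype.card F : ℤ) - 1) - K 7 (-1) ((Fintype.card F : ℤ) - 1) else 0 := by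
    intro b δ
    rw [sK_val 7 _ _ _ (chi_quad hF b δ) (rr_quad hF b δ)]
    split_ifs with h0
    · subst h0; simp
    · simp
  rw [sum_mon_two hF, Finset.sum_congr rfl (fun b _ => Finset.sum_congr rfl (fun δ _ => h2 b δ))] at h
  simp only [Finset.sum_add_distrib, Finset.sum_ite_eq', Finset.mem_univ, if_true,
    Finset.sum_const, nsmul_eq_mul, Finset.card_univ] at h
  have h3 := sum_fun_chi hF (fun t => K 7 (-1) ((Fintype.card F : ℤ) - (t + 1)))
  rw [show (Fintype.card F : ℤ) - (-1 + 1) = Fintype.card F by ring,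
    show (Fintype.card F : ℤ) - (1 + 1) = Fintype.card F - 2 by ring,
    show (Fintype.card F : ℤ) - (0 + 1) = Fintype.card F - 1 by ring] at h3
  apply mul_left_cancel₀ (pow_ne_zero 3 hq)
  linear_combination 2 * h + (Fintype.card F : ℤ) ^ 5 * h3

lemma W51 (hF : ringChar F ≠ 2) : Wf F 5 1 = (Fintype.card F : ℤ) ^ 2 *
    (K 5 ((Fintype.card F : ℤ) - 1) ((Fintype.card F : ℤ) - 1)
      + ((Fintype.card F : ℤ) - 1) * K 5 (-1) ((Fintype.card F : ℤ) - 2)) := by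
  have hq := (card_pos' (F := F)).ne'
  have h2 : ∀ y : F, ∑ c ∈ mon F 3, sK 5 ((X - C y) * c) = (Fintype.card F : ℤ) *
    (K 5 ((Fintype.card F : ℤ) - 1) ((Fintype.card F : ℤ) - 1)
      + ((Fintype.card F : ℤ) - 1) * K 5 (-1) ((Fintype.card F : ℤ) - 2)) := by
    intro y
    have h := sK_odd_sum hF 3 1 2 (X - C y) rfl (by norm_num)
    norm_num only at h
    rw [sum_mon_one (fun c => sK 5 ((X - C y) * c)), ← Finset.add_sum_erase _ _ (Finset.mem_univ y),
      sK_lin3 hF,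
      Finset.sum_congr rfl (fun z hz => sK_lin2 hF 5 y z (Finset.mem_erase.mp hz).1)] at h
    simp only [Finset.sum_const, nsmul_eq_mul, card_er] at h
    apply mul_left_cancel₀ (pow_ne_zero 2 hq)
    rw [h]; ring
  rw [W1, Finset.sum_congr rfl (fun y _ => h2 y)]
  simp only [Finset.sum_const, nsmul_eq_mul, Finset.card_univ]
  ring

lemma W41 (hF : ringChar F ≠ 2) : Wf F 4 1 = - (Fintype.card F : ℤ) ^ 2 * K 4 0 ((Fintype.card F : ℤ) - 1) := by
  have hq := (card_pos' (F := F)).ne'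
  have h2 : ∀ y : F, ∑ c ∈ mon F 3, sK 4 ((X - C y) * c) =
      - (Fintype.card F : ℤ) * K 4 0 ((Fintype.card F : ℤ) - 1) := by
    intro y
    have h := sK_even_sum hF 3 0 2 (X - C y) rfl 0
      (fun S hS => DT_zero S (by omega)) (by norm_num)
    norm_num only at h
    rw [mon_zero, Finset.sum_singleton, mul_one, sK_lin hF] at h
    apply mul_left_cancel₀ (pow_ne_zero 2 hq)
    rw [h]; ring
  rw [W1, Finset.sum_congr rfl (fun y _ => h2 y)]
  simp only [Finset.sum_const, nsmul_eq_mul, Finset.card_univ]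
  ring

lemma W32 (hF : ringChar F ≠ 2) : Wf F 3 2 =
    (Fintype.card F : ℤ) ^ 2 * ((Fintype.card F : ℤ) - 1) * K 3 (-1) ((Fintype.card F : ℤ) - 2) := by
  have hq := (card_pos' (F := F)).ne'
  have h2 : ∀ y : F, ∀ z ∈ univ.erase y, ∑ c ∈ mon F 2, sK 3 ((X - C y) * (X - C z) * c) =
      (Fintype.card F : ℤ) * K 3 (-1) ((Fintype.card F : ℤ) - 2) := by
    intro y z hz
    have h := sK_odd_sum hF 2 0 1 ((X - C y) * (X - C z)) rfl (by norm_num)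
    norm_num only at h
    rw [mon_zero, Finset.sum_singleton, mul_one, sK_lin2 hF 3 y z (Finset.mem_erase.mp hz).1] at h
    apply mul_left_cancel₀ (pow_ne_zero 1 hq)
    rw [h]; ring
  rw [W2, Finset.sum_congr rfl (fun y _ => Finset.sum_congr rfl (fun z hz => h2 y z hz))]
  simp only [Finset.sum_const, nsmul_eq_mul, Finset.card_univ, card_er]
  ring

/-- all totals -/
noncomputable def tt (F : Type*) [Field F] [Fintype F] [DecidableEq F] (j : ℕ) : ℤ :=
  ∑ D ∈ mon F 4, (1 + ∑ x, chi D x) ^ j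

lemma tt1 (hF : ringChar F ≠ 2) (q : ℤ) (hq : q = Fintype.card F) :
    tt F 1 = (1) * q ^ 4 := by
  have h : tt F 1 = (1) * Wf F 0 0 + (1) * Wf F 1 0 := by
    unfold tt Wf
    simp only [Finset.mul_sum, ← Finset.sum_add_distrib]
    apply Finset.sum_congr rfl
    intro D _
    simp only [sK, ← hq, ff, K]
    push_cast
    ring
  rw [h]
  rw [W00,
    W0z hF 1 (by norm_num) (by norm_num), ← hq]
  push_cast
  ring

lemma tt3 (hF : ringChar F ≠ 2) (q : ℤ) (hq : q = Fintype.card F) :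
    tt F 3 = (-2) * q ^ 4 + (3) * q ^ 5 := by
  have h : tt F 3 = ((1) + (3) * q ^ 1) * Wf F 0 0 + (-3) * Wf F 0 1 + ((1) + (3) * q ^ 1) * Wf F 1 0 + (-3) * Wf F 1 1
        + (3) * Wf F 2 0 + (1) * Wf F 3 0 := by
    unfold tt Wf
    simp only [Finset.mul_sum, ← Finset.sum_add_distrib]
    apply Finset.sum_congr rfl
    intro D _
    simp only [sK, ← hq, ff, K]
    push_cast
    ring
  rw [h]
  rw [W00,
    W0z hF 1 (by norm_num) (by norm_num),
    W01,
    W1z hF 1 (by norm_num) (by norm_num),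
    W0z hF 2 (by norm_num) (by norm_num),
    W0z hF 3 (by norm_num) (by norm_num), ← hq]
  push_cast
  ring

lemma tt5 (hF : ringChar F ≠ 2) (q : ℤ) (hq : q = Fintype.card F) :
    tt F 5 = (9) * q ^ 3 + (-19) * q ^ 4 + (5) * q ^ 5 + (5) * q ^ 6 + (1) * q ^ 7 := by
  have h : tt F 5 = ((1) + (15) * q ^ 2) * Wf F 0 0 + ((15) + (-30) * q ^ 1) * Wf F 0 1 + (15) * Wf F 0 2 + ((1)
        + (15) * q ^ 2) * Wf F 1 0 + ((15) + (-30) * q ^ 1) * Wf F 1 1 + (15) * Wf F 1 2 + ((-30)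
        + (30) * q ^ 1) * Wf F 2 0 + (-30) * Wf F 2 1 + ((-10) + (10) * q ^ 1) * Wf F 3 0
        + (-10) * Wf F 3 1 + (5) * Wf F 4 0 + (1) * Wf F 5 0 := by
    unfold tt Wf
    simp only [Finset.mul_sum, ← Finset.sum_add_distrib]
    apply Finset.sum_congr rfl
    intro D _
    simp only [sK, ← hq, ff, K]
    push_cast
    ring
  rw [h]
  rw [W00,
    W0z hF 1 (by norm_num) (by norm_num),
    W01,
    W1z hF 1 (by norm_num) (by norm_num),
    W0z hF 2 (by norm_num) (by norm_num),
    W0z hF 3 (by norm_num) (by norm_num),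
    W02,
    W2z hF 1 (by norm_num) (by norm_num),
    W1z hF 2 (by norm_num) (by norm_num),
    W1z hF 3 (by norm_num) (by norm_num),
    W0z hF 4 (by norm_num) (by norm_num),
    W50 hF, ← hq]
  simp only [K]
  push_cast
  ring

lemma tt7 (hF : ringChar F ≠ 2) (q : ℤ) (hq : q = Fintype.card F) :
    tt F 7 = (20) * q ^ 3 + (-27) * q ^ 4 + (7) * q ^ 5 + (-35) * q ^ 6 + (35) * q ^ 7 + (1) * q ^ 9 := by
  have h : tt F 7 = ((1) + (63) * q ^ 1 + (-105) * q ^ 2 + (105) * q ^ 3) * Wf F 0 0 + ((-273) + (525) * q ^ 1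
        + (-315) * q ^ 2) * Wf F 0 1 + ((-420) + (315) * q ^ 1) * Wf F 0 2 + (-105) * Wf F 0 3 + ((1)
        + (63) * q ^ 1 + (-105) * q ^ 2 + (105) * q ^ 3) * Wf F 1 0 + ((-273) + (525) * q ^ 1
        + (-315) * q ^ 2) * Wf F 1 1 + ((-420) + (315) * q ^ 1) * Wf F 1 2 + (-105) * Wf F 1 3 + ((693)
        + (-840) * q ^ 1 + (315) * q ^ 2) * Wf F 2 0 + ((1155) + (-630) * q ^ 1) * Wf F 2 1
        + (315) * Wf F 2 2 + ((231) + (-280) * q ^ 1 + (105) * q ^ 2) * Wf F 3 0 + ((385)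
        + (-210) * q ^ 1) * Wf F 3 1 + (105) * Wf F 3 2 + ((-245) + (105) * q ^ 1) * Wf F 4 0
        + (-105) * Wf F 4 1 + ((-49) + (21) * q ^ 1) * Wf F 5 0 + (-21) * Wf F 5 1 + (7) * Wf F 6 0
        + (1) * Wf F 7 0 := by
    unfold tt Wf
    simp only [Finset.mul_sum, ← Finset.sum_add_distrib]
    apply Finset.sum_congr rfl
    intro D _
    simp only [sK, ← hq, ff, K]
    push_cast
    ring
  rw [h]
  have h7 := W70 hF
  have e : ∀ a b : ℤ, 2 * a = 2 * b → a = b := fun a b h => by linarith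
  apply e
  rw [mul_add 2 _ (1 * Wf F 7 0), one_mul, h7]
  rw [W00,
    W0z hF 1 (by norm_num) (by norm_num),
    W01,
    W1z hF 1 (by norm_num) (by norm_num),
    W0z hF 2 (by norm_num) (by norm_num),
    W0z hF 3 (by norm_num) (by norm_num),
    W02,
    W2z hF 1 (by norm_num) (by norm_num),
    W1z hF 2 (by norm_num) (by norm_num),
    W1z hF 3 (by norm_num) (by norm_num),
    W0z hF 4 (by norm_num) (by norm_num),
    W50 hF,
    W03,
    W3z hF 1 (by norm_num) (by norm_num),
    W2z hF 2 (by norm_num) (by norm_num),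
    W32 hF,
    W41 hF,
    W51 hF,
    W60 hF, ← hq]
  simp only [K]
  push_cast
  ring

end tot

section nonsq

variable {F : Type*} [Field F] [Fintype F] [DecidableEq F]

lemma nonsq_iff (D : F[X]) (hD : D.Monic) : ¬ Squarefree D ↔
    ∃ g h : F[X], g.Monic ∧ h.Monic ∧ 1 ≤ g.natDegree ∧ D = g ^ 2 * h := by
  constructor
  · intro hn
    unfold Squarefree at hn
    push Not at hn
    obtain ⟨g, ⟨h, hh⟩, hg⟩ := hn
    have hD0 := hD.ne_zero
    have hg0 : g ≠ 0 := by rintro rfl; simp at hh; exact hD0 hh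
    have hc : g.leadingCoeff ≠ 0 := leadingCoeff_ne_zero.mpr hg0
    have hgm : (g * C g.leadingCoeff⁻¹).Monic := monic_mul_leadingCoeff_inv hg0
    have heq : D = (g * C g.leadingCoeff⁻¹) ^ 2 * (C (g.leadingCoeff ^ 2) * h) := by
      rw [hh]
      have : C g.leadingCoeff⁻¹ * C g.leadingCoeff = (1 : F[X]) := by
        rw [← C_mul, inv_mul_cancel₀ hc, C_1]
      rw [C_pow]
      linear_combination (-g ^ 2 * h * (C g.leadingCoeff⁻¹ * C g.leadingCoeff + 1)) * this
    refine ⟨g * C g.leadingCoeff⁻¹, C (g.leadingCoeff ^ 2) * h, hgm, ?_, ?_, heq⟩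
    · rw [heq] at hD
      exact (hgm.pow 2).of_mul_monic_left hD
    · rw [natDegree_mul_C (inv_ne_zero hc)]
      by_contra h0
      apply hg
      have h00 : g.natDegree = 0 := by omega
      rw [eq_C_of_natDegree_eq_zero h00] at hg0 ⊢
      rw [isUnit_C]
      exact IsUnit.mk0 _ (fun h => hg0 (by rw [h, C_0]))
  · rintro ⟨g, h, hg, hh, h1, rfl⟩ hs
    have := hs g ⟨h, by ring⟩
    have := natDegree_eq_zero_of_isUnit this
    omega

lemma monic_one_eq (g : F[X]) (hg : g.Monic) (h : g.natDegree = 1) : ∃ y, g = X - C y := by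
  have : g ∈ mon F 1 := (mem_mon 1 g).mpr ⟨hg, h⟩
  refine ⟨-g.coeff 0, ?_⟩
  have := hg.eq_X_add_C h
  rw [C_neg, sub_neg_eq_add]
  exact this

lemma monic_sq_inj (A B : F[X]) (hF : ringChar F ≠ 2) (hA : A.Monic) (hB : B.Monic) (h : A ^ 2 = B ^ 2) : A = B := by
  rcases sq_eq_sq_iff_eq_or_eq_neg.mp h with h | h
  · exact h
  · exfalso
    have h1 := congrArg leadingCoeff h
    rw [leadingCoeff_neg, hA.leadingCoeff, hB.leadingCoeff] at h1
    apply two_ne hF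
    linear_combination h1

lemma deg_sq_mul (g h : F[X]) (hg : g.Monic) (hh : h.Monic) :
    (g ^ 2 * h).natDegree = 2 * g.natDegree + h.natDegree := by
  rw [(hg.pow 2).natDegree_mul hh, hg.natDegree_pow]

lemma nonsq_sum (hF : ringChar F ≠ 2) (Φ : F[X] → ℤ) :
    ∑ D ∈ (mon F 4).filter (fun D => ¬ Squarefree D), Φ D
      = ∑ y : F, ∑ Q ∈ (mon F 2).filter Squarefree, Φ ((X - C y) ^ 2 * Q)
        + ∑ A ∈ mon F 2, Φ (A ^ 2) := by
  have hset : (mon F 4).filter (fun D => ¬ Squarefree D)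
      = ((univ : Finset F) ×ˢ (mon F 2).filter Squarefree).image (fun z => (X - C z.1) ^ 2 * z.2)
        ∪ (mon F 2).image (fun A => A ^ 2) := by
    ext D
    simp only [Finset.mem_filter, Finset.mem_union, Finset.mem_image, Finset.mem_product,
      Finset.mem_univ, true_and, Prod.exists]
    constructor
    · rintro ⟨hD, hs⟩
      rw [mem_mon] at hD
      obtain ⟨g, h, hg, hh, h1, rfl⟩ := (nonsq_iff D hD.1).mp hs
      have hd := hD.2
      rw [deg_sq_mul g h hg hh] at hd
      have hcase : g.natDegree = 1 ∨ g.natDegree = 2 := by omega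
      rcases hcase with h1 | h1
      · obtain ⟨y, rfl⟩ := monic_one_eq g hg h1
        by_cases hq : Squarefree h
        · left
          exact ⟨y, h, ⟨(mem_mon 2 h).mpr ⟨hh, by omega⟩, hq⟩, rfl⟩
        · right
          obtain ⟨u, v, hu, hv, hu1, rfl⟩ := (nonsq_iff h hh).mp hq
          rw [deg_sq_mul u v hu hv] at hd
          have hv1 : v = 1 := hv.natDegree_eq_zero.mp (by omega)
          refine ⟨(X - C y) * u, (mem_mon 2 _).mpr ⟨hg.mul hu, ?_⟩, by rw [hv1]; ring⟩
          rw [hg.natDegree_mul hu]; omega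
      · right
        have hv1 : h = 1 := hh.natDegree_eq_zero.mp (by omega)
        exact ⟨g, (mem_mon 2 _).mpr ⟨hg, h1⟩, by rw [hv1]; ring⟩
    · rintro (⟨y, Q, ⟨hQ, hs⟩, rfl⟩ | ⟨A, hA, rfl⟩)
      · rw [mem_mon] at hQ
        have hm := monic_X_sub_C y
        have hM : ((X - C y) ^ 2 * Q).Monic := (hm.pow 2).mul hQ.1
        refine ⟨(mem_mon 4 _).mpr ⟨hM, ?_⟩, ?_⟩
        · rw [deg_sq_mul _ _ hm hQ.1, natDegree_X_sub_C, hQ.2]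
        · exact (nonsq_iff _ hM).mpr ⟨_, _, hm, hQ.1, by rw [natDegree_X_sub_C], rfl⟩
      · rw [mem_mon] at hA
        have hM := hA.1.pow 2
        refine ⟨(mem_mon 4 _).mpr ⟨hM, ?_⟩, ?_⟩
        · rw [hA.1.natDegree_pow, hA.2]
        · exact (nonsq_iff _ hM).mpr ⟨A, 1, hA.1, monic_one, by omega, by ring⟩
  rw [hset, Finset.sum_union, Finset.sum_image, Finset.sum_image, Finset.sum_product]
  · intro A hA B hB h
    exact monic_sq_inj A B hF ((mem_mon 2 A).mp hA).1 ((mem_mon 2 B).mp hB).1 h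
  · rintro ⟨y, Q⟩ hQ ⟨z, R⟩ hR h
    simp only [Finset.coe_product, Set.mem_prod, Finset.mem_coe, Finset.mem_filter] at hQ hR
    have h : (X - C y) ^ 2 * Q = (X - C z) ^ 2 * R := h
    by_cases hyz : y = z
    · subst hyz
      have := mul_left_cancel₀ (pow_ne_zero 2 (X_sub_C_ne_zero y)) h
      rw [this]
    · exfalso
      have hc : IsCoprime ((X - C y) ^ 2) ((X - C z) ^ 2) :=
        (isCoprime_X_sub_C_of_isUnit_sub (sub_ne_zero.mpr hyz).isUnit).pow
      have hd : (X - C y) ^ 2 ∣ R := hc.dvd_of_dvd_mul_left ⟨Q, h.symm⟩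
      rw [sq] at hd
      exact not_isUnit_X_sub_C y (hR.2.2 _ hd)
  · rw [Finset.disjoint_left]
    intro D h1 h2
    simp only [Finset.mem_filter, Finset.mem_image, Finset.mem_product,
      Finset.mem_univ, true_and, Prod.exists] at h1 h2
    obtain ⟨y, Q, ⟨hQ, hs⟩, rfl⟩ := h1
    obtain ⟨A, hA, h⟩ := h2
    have hd : (X - C y) ∣ A := by
      apply (prime_X_sub_C y).dvd_of_dvd_pow (n := 2)
      rw [h, sq, mul_assoc]; exact Dvd.intro _ rfl
    obtain ⟨B, rfl⟩ := hd
    have hB : B * B = Q := by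
      apply mul_left_cancel₀ (pow_ne_zero 2 (X_sub_C_ne_zero y))
      rw [← h]; ring
    have hu := hs B ⟨1, by rw [hB, mul_one]⟩
    have h0 := natDegree_eq_zero_of_isUnit hu
    rw [mem_mon] at hQ
    have h2 := hQ.2
    have := natDegree_mul_le (p := B) (q := B)
    rw [hB] at this
    omega

lemma sqf_quad (hF : ringChar F ≠ 2) (b δ : F) : Squarefree ((X + C b) ^ 2 - C δ) ↔ δ ≠ 0 := by
  have hM : ((X + C b) ^ 2 - C δ) ∈ mon F 2 := by
    rw [mem_mon]
    have hm : ((X + C b) ^ 2).Monic := (monic_X_add_C b).pow 2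
    have hd : ((X + C b) ^ 2).degree = 2 := by
      rw [degree_pow, degree_X_add_C]; rfl
    have hlt : (C δ).degree < ((X + C b) ^ 2).degree := by
      rw [hd]; exact lt_of_le_of_lt degree_C_le (by norm_num)
    refine ⟨hm.sub_of_left hlt, ?_⟩
    apply natDegree_eq_of_degree_eq_some
    rw [degree_sub_eq_left_of_degree_lt hlt, hd]; rfl
  rw [mem_mon] at hM
  rw [← not_iff_not, nonsq_iff _ hM.1, not_not]
  constructor
  · rintro ⟨g, h, hg, hh, h1, he⟩
    have hd := hM.2
    rw [he, deg_sq_mul g h hg hh] at hd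
    have hv1 : h = 1 := hh.natDegree_eq_zero.mp (by omega)
    obtain ⟨y, rfl⟩ := monic_one_eq g hg (by omega)
    subst hv1
    have e1 := congrArg (eval y) he
    have e2 := congrArg (eval (-b)) he
    have e3 := congrArg (eval (y + 1)) he
    simp at e1 e2 e3
    have : 2 * (y + b) = 0 := by linear_combination e3 - e1
    have h0 : y + b = 0 := by
      rcases mul_eq_zero.mp this with h | h
      · exact absurd h (two_ne hF)
      · exact h
    rw [h0] at e1
    simpa using e1
  · rintro rfl
    exact ⟨X + C b, 1, monic_X_add_C b, monic_one, by rw [natDegree_X_add_C], by simp⟩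

lemma sum_sqf_quad (hF : ringChar F ≠ 2) (Φ : F[X] → ℤ) :
    ∑ Q ∈ (mon F 2).filter Squarefree, Φ Q
      = ∑ b : F, ∑ δ ∈ univ.erase (0 : F), Φ ((X + C b) ^ 2 - C δ) := by
  rw [Finset.sum_filter, sum_mon_two hF]
  apply Finset.sum_congr rfl
  intro b _
  simp_rw [sqf_quad hF]
  rw [← Finset.sum_filter]
  apply Finset.sum_congr _ (fun _ _ => rfl)
  ext; simp

lemma chi_sq_mul (y : F) (Q : F[X]) : ∑ x, chi ((X - C y) ^ 2 * Q) x = ∑ x, chi Q x - chi Q y := by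
  rw [← Finset.add_sum_erase _ _ (Finset.mem_univ y), ← Finset.add_sum_erase _ (chi Q) (Finset.mem_univ y)]
  have : ∑ x ∈ univ.erase y, chi ((X - C y) ^ 2 * Q) x = ∑ x ∈ univ.erase y, chi Q x := by
    apply Finset.sum_congr rfl
    intro x hx
    rw [chi_mul]
    have : chi ((X - C y) ^ 2) x = 1 := by
      simp only [chi, eval_pow, eval_sub, eval_X, eval_C]
      exact quadraticChar_sq_one' (sub_ne_zero.mpr (Finset.mem_erase.mp hx).1)
    rw [this, one_mul]
  rw [this]
  have : chi ((X - C y) ^ 2 * Q) y = 0 := by simp [chi]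
  rw [this]; ring

/-- the shifted character sum -/
noncomputable def sD (D : F[X]) : ℤ := 1 + ∑ x, chi D x

lemma sD_type1 (hF : ringChar F ≠ 2) (y b δ : F) (hδ : δ ≠ 0) :
    sD ((X - C y) ^ 2 * ((X + C b) ^ 2 - C δ)) = - quadraticChar F ((y + b) ^ 2 - δ) := by
  rw [sD, chi_sq_mul, chi_quad hF, if_neg hδ]
  simp [chi, -quadraticChar_apply]
  ring

lemma sD_type2 (hF : ringChar F ≠ 2) (b δ : F) :
    sD (((X + C b) ^ 2 - C δ) ^ 2) = Fintype.card F - quadraticChar F δ := by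
  have : ∑ x, chi (((X + C b) ^ 2 - C δ) ^ 2) x = ∑ x, chi ((X + C b) ^ 2 - C δ) x ^ 2 := by
    apply Finset.sum_congr rfl
    intro x _
    rw [sq ((X + C b) ^ 2 - C δ), chi_mul]
    exact (sq _).symm
  rw [sD, this, sum_chi_sq, rr_quad hF]
  ring

/-- squarefree moments -/
noncomputable def mm (F : Type*) [Field F] [Fintype F] [DecidableEq F] (j : ℕ) : ℤ :=
  ∑ D ∈ (mon F 4).filter Squarefree, sD D ^ j

lemma mm_add (j : ℕ) : mm F j + ∑ D ∈ (mon F 4).filter (fun D => ¬ Squarefree D), sD D ^ j = tt F j := by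
  unfold mm tt
  rw [Finset.sum_filter_add_sum_filter_not]
  rfl

lemma sum_sq_shift (y : F) : ∑ b : F, quadraticChar F ((y + b) ^ 2) = Fintype.card F - 1 := by
  simp_rw [add_comm y]
  rw [sum_shift (fun b => quadraticChar F (b ^ 2)) y]
  rw [← Finset.add_sum_erase _ _ (Finset.mem_univ (0 : F)),
      Finset.sum_congr rfl (fun x hx => quadraticChar_sq_one' (Finset.mem_erase.mp hx).1)]
  rw [Finset.sum_const, nsmul_eq_mul, card_er]
  simp

lemma odd_pow (a : F) (i : ℕ) : (- quadraticChar F a) ^ (2 * i + 1) = - quadraticChar F a := by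
  rw [Odd.neg_pow ⟨i, rfl⟩]
  congr 1
  by_cases h : a = 0
  · subst h; simp
  · rw [pow_succ, pow_mul, quadraticChar_sq_one h, one_pow, one_mul]

lemma mm_odd (hF : ringChar F ≠ 2) (i : ℕ) (q : ℤ) (hq : q = Fintype.card F) :
    2 * mm F (2 * i + 1) = 2 * tt F (2 * i + 1) - 2 * (q * (q - 1))
      - q * (2 * q ^ (2 * i + 1) + (q - 1) * ((q - 1) ^ (2 * i + 1) + (q + 1) ^ (2 * i + 1))) := by
  have h := mm_add (F := F) (2 * i + 1)
  rw [nonsq_sum hF] at h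
  have h1 : ∑ y : F, ∑ Q ∈ (mon F 2).filter Squarefree, sD ((X - C y) ^ 2 * Q) ^ (2 * i + 1) = q * (q - 1) := by
    have : ∀ y : F, ∑ Q ∈ (mon F 2).filter Squarefree, sD ((X - C y) ^ 2 * Q) ^ (2 * i + 1) = q - 1 := by
      intro y
      rw [sum_sqf_quad hF (fun Q => sD ((X - C y) ^ 2 * Q) ^ (2 * i + 1)), hq, ← sum_sq_shift y]
      apply Finset.sum_congr rfl
      intro b _
      rw [Finset.sum_congr rfl (fun δ hδ => by
        rw [sD_type1 hF y b δ (Finset.mem_erase.mp hδ).1, odd_pow])]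
      have h0 := sum_aff hF (-1) ((y + b) ^ 2) (by simp)
      rw [← Finset.add_sum_erase _ _ (Finset.mem_univ (0 : F))] at h0
      rw [Finset.sum_neg_distrib]
      simp only [mul_zero, zero_add] at h0
      rw [neg_eq_iff_add_eq_zero, add_comm, ← h0]
      congr 1
      apply Finset.sum_congr rfl
      intro δ _
      congr 1
      ring
    rw [Finset.sum_congr rfl (fun y _ => this y), Finset.sum_const, nsmul_eq_mul, Finset.card_univ, ← hq]
  have h2 : 2 * ∑ A ∈ mon F 2, sD (A ^ 2) ^ (2 * i + 1) =
      q * (2 * q ^ (2 * i + 1) + (q - 1) * ((q - 1) ^ (2 * i + 1) + (q + 1) ^ (2 * i + 1))) := by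
    rw [sum_mon_two hF]
    simp_rw [sD_type2 hF]
    have h3 := sum_fun_chi hF (fun t => ((Fintype.card F : ℤ) - t) ^ (2 * i + 1))
    rw [Finset.sum_const, nsmul_eq_mul, Finset.card_univ]
    rw [← hq] at h3 ⊢
    simp only [sub_zero, sub_neg_eq_add] at h3
    linear_combination q * h3
  rw [h1] at h
  linear_combination 2 * h - h2

lemma mm_zero (hF : ringChar F ≠ 2) (q : ℤ) (hq : q = Fintype.card F) :
    mm F 0 = q ^ 4 - q ^ 3 := by
  have h := mm_add (F := F) 0
  rw [nonsq_sum hF] at h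
  simp only [pow_zero, tt] at h
  rw [sum_sqf_quad hF (fun _ => 1)] at h
  simp only [Finset.sum_const, nsmul_eq_mul, card_er, card_mon, Finset.card_univ, mul_one, ← hq] at h
  linear_combination h

lemma mm1 (hF : ringChar F ≠ 2) (q : ℤ) (hq : q = Fintype.card F) :
    mm F 1 = q * ((q - 1) * (q ^ 2 - 1)) := by
  have h := mm_odd hF 0 q hq
  norm_num only at h
  rw [tt1 hF q hq] at h
  have : 2 * mm F 1 = 2 * (q * ((q - 1) * (q ^ 2 - 1))) := by rw [h]; ring
  linarith

lemma mm3 (hF : ringChar F ≠ 2) (q : ℤ) (hq : q = Fintype.card F) :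
    mm F 3 = q * ((q - 1) * (2 * q ^ 3 - 3 * q - 1)) := by
  have h := mm_odd hF 1 q hq
  norm_num only at h
  rw [tt3 hF q hq] at h
  have : 2 * mm F 3 = 2 * (q * ((q - 1) * (2 * q ^ 3 - 3 * q - 1))) := by rw [h]; ring
  linarith

lemma mm5 (hF : ringChar F ≠ 2) (q : ℤ) (hq : q = Fintype.card F) :
    mm F 5 = q * ((q - 1) * (5 * q ^ 4 - 9 * q ^ 2 - 5 * q - 1)) := by
  have h := mm_odd hF 2 q hq
  norm_num only at h
  rw [tt5 hF q hq] at h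
  have : 2 * mm F 5 = 2 * (q * ((q - 1) * (5 * q ^ 4 - 9 * q ^ 2 - 5 * q - 1))) := by rw [h]; ring
  linarith

lemma mm7 (hF : ringChar F ≠ 2) (q : ℤ) (hq : q = Fintype.card F) :
    mm F 7 = q * ((q - 1) * (14 * q ^ 5 - 28 * q ^ 3 - 20 * q ^ 2 - 7 * q - 1)) := by
  have h := mm_odd hF 3 q hq
  norm_num only at h
  rw [tt7 hF q hq] at h
  have : 2 * mm F 7 = 2 * (q * ((q - 1) * (14 * q ^ 5 - 28 * q ^ 3 - 20 * q ^ 2 - 7 * q - 1))) := by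
    rw [h]; ring
  linarith

end nonsq

section transfer

variable {F : Type*} [Field F] [Fintype F] [DecidableEq F]

/-- depressed quartic -/
noncomputable def dep (X0 Y0 g2 : F) : F[X] := X ^ 4 + pol ![g2 - 3 * X0 ^ 2, 4 * Y0, - (6 * X0), 0]

/-- shifted depressed quartic -/
noncomputable def qu (e X0 Y0 g2 : F) : F[X] := X ^ 4 + pol ![e ^ 4 - 6 * X0 * e ^ 2 + 4 * Y0 * e + g2 - 3 * X0 ^ 2,
  4 * e ^ 3 - 12 * X0 * e + 4 * Y0, 6 * e ^ 2 - 6 * X0, 4 * e]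

lemma dep_eq (X0 Y0 g2 : F) : dep X0 Y0 g2 = X ^ 4 - 6 * C X0 * X ^ 2 + 4 * C Y0 * X + (C g2 - 3 * C X0 ^ 2) := by
  have h3 : (C (3 : F)) = 3 := rfl
  have h4 : (C (4 : F)) = 4 := rfl
  have h6 : (C (6 : F)) = 6 := rfl
  simp [dep, pol, Fin.sum_univ_four, h3, h4, h6]
  ring

lemma dep_eval (X0 Y0 g2 x : F) :
    (dep X0 Y0 g2).eval x = x ^ 4 - 6 * X0 * x ^ 2 + 4 * Y0 * x + (g2 - 3 * X0 ^ 2) := by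
  rw [dep, eval_add, pol_eval]
  simp [Fin.sum_univ_four]
  ring

lemma qu_comp (e X0 Y0 g2 : F) : qu e X0 Y0 g2 = (dep X0 Y0 g2).comp (X + C e) := by
  have h3 : (C (3 : F)) = 3 := rfl
  have h4 : (C (4 : F)) = 4 := rfl
  have h6 : (C (6 : F)) = 6 := rfl
  have h12 : (C (12 : F)) = 12 := rfl
  simp [dep, qu, pol, Fin.sum_univ_four, h3, h4, h6, h12]
  ring

lemma sum_qu (hF : ringChar F ≠ 2) (h3 : (3 : F) ≠ 0) (Φ : F[X] → ℤ) :
    ∑ D ∈ mon F 4, Φ D = ∑ e : F, ∑ X0 : F, ∑ Y0 : F, ∑ g2 : F, Φ (qu e X0 Y0 g2) := by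
  have h2 := two_ne hF
  have h4 : (4 : F) ≠ 0 := by
    have : (4 : F) = 2 * 2 := by norm_num
    rw [this]; exact mul_ne_zero h2 h2
  have h6 : (6 : F) ≠ 0 := by
    have : (6 : F) = 2 * 3 := by norm_num
    rw [this]; exact mul_ne_zero h2 h3
  have hs : ∑ e : F, ∑ X0 : F, ∑ Y0 : F, ∑ g2 : F, Φ (qu e X0 Y0 g2)
      = ∑ z : F × F × F × F, Φ (qu z.1 z.2.1 z.2.2.1 z.2.2.2) := by
    simp only [Fintype.sum_prod_type]
  rw [hs, sum_mon]
  symm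
  apply Fintype.sum_bijective (fun z : F × F × F × F =>
    ![z.1 ^ 4 - 6 * z.2.1 * z.1 ^ 2 + 4 * z.2.2.1 * z.1 + z.2.2.2 - 3 * z.2.1 ^ 2,
  4 * z.1 ^ 3 - 12 * z.2.1 * z.1 + 4 * z.2.2.1, 6 * z.1 ^ 2 - 6 * z.2.1, 4 * z.1])
  · rw [Fintype.bijective_iff_injective_and_card]
    constructor
    · rintro ⟨a, b, c, d⟩ ⟨a', b', c', d'⟩ h
      have e0 := congrFun h 0
      have e1 := congrFun h 1
      have e2 := congrFun h 2
      have e3 := congrFun h 3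
      simp only [Matrix.cons_val] at e0 e1 e2 e3
      have ea := mul_left_cancel₀ h4 e3
      subst ea
      have eb : b = b' := mul_left_cancel₀ h6 (by linear_combination -e2)
      subst eb
      have ec : c = c' := mul_left_cancel₀ h4 (by linear_combination e1)
      subst ec
      have ed : d = d' := by linear_combination e0
      subst ed
      rfl
    · simp; ring
  · rintro ⟨a, b, c, d⟩
    rfl

lemma sD_qu (e X0 Y0 g2 : F) : sD (qu e X0 Y0 g2) = sD (dep X0 Y0 g2) := by
  rw [qu_comp, sD, sD]
  congr 1
  rw [← sum_shift (chi (dep X0 Y0 g2)) e]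
  apply Finset.sum_congr rfl
  intro x _
  simp [chi, -quadraticChar_apply]

lemma sqf_comp (P : F[X]) (e : F) (h : Squarefree (P.comp (X + C e))) : Squarefree P := by
  intro g ⟨k, hk⟩
  have hu := h (g.comp (X + C e)) ⟨k.comp (X + C e), by rw [hk]; simp⟩
  have h0 := natDegree_eq_zero_of_isUnit hu
  rw [natDegree_comp, natDegree_X_add_C, mul_one] at h0
  have h1 := eq_C_of_natDegree_eq_zero h0
  rw [h1, C_comp] at hu
  rw [h1]
  exact hu

lemma sqf_qu (e X0 Y0 g2 : F) : Squarefree (qu e X0 Y0 g2) ↔ Squarefree (dep X0 Y0 g2) := by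
  rw [qu_comp]
  constructor
  · exact sqf_comp _ e
  · intro h
    apply sqf_comp _ (-e)
    rw [comp_assoc]
    simpa using h

/-- the singular condition -/
def Sing (g2 g3 : F) : Prop := ∃ x : F, 4 * x ^ 3 - g2 * x - g3 = 0 ∧ 12 * x ^ 2 = g2

lemma dep_mon (X0 Y0 g2 : F) : (dep X0 Y0 g2).Monic ∧ (dep X0 Y0 g2).natDegree = 4 := by
  rw [← mem_mon, mon, Finset.mem_image]
  exact ⟨_, Finset.mem_univ _, rfl⟩

lemma sqf_dep (hF : ringChar F ≠ 2) (X0 Y0 g2 : F) :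
    ¬ Squarefree (dep X0 Y0 g2) ↔ Sing g2 (4 * X0 ^ 3 - g2 * X0 - Y0 ^ 2) := by
  have h2 := two_ne hF
  have hm := dep_mon X0 Y0 g2
  rw [nonsq_iff _ hm.1]
  constructor
  · rintro ⟨g, h, hg, hh, h1, he⟩
    have hd := hm.2
    rw [he, deg_sq_mul g h hg hh] at hd
    have hcase : g.natDegree = 1 ∨ g.natDegree = 2 := by omega
    rcases hcase with h1 | h1
    · obtain ⟨y, rfl⟩ := monic_one_eq g hg h1
      have e1 := congrArg (eval y) he
      have e2 := congrArg (fun P => eval y (derivative P)) he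
      rw [dep_eval] at e1
      simp [dep_eq, derivative_pow] at e1 e2
      have e3 : 2 * (2 * (y ^ 3 - 3 * X0 * y + Y0)) = 0 := by linear_combination e2
      have e4 : y ^ 3 - 3 * X0 * y + Y0 = 0 := by simpa [h2] using e3
      have eY : Y0 = 3 * X0 * y - y ^ 3 := by linear_combination e4
      subst eY
      have eg : g2 = 3 * (y ^ 2 - X0) ^ 2 := by linear_combination e1
      subst eg
      refine ⟨(y ^ 2 - X0) / 2, ?_, ?_⟩
      · field_simp
        ring
      · field_simp
        ring
    · have hv1 : h = 1 := hh.natDegree_eq_zero.mp (by omega)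
      subst hv1
      have hgm : g ∈ mon F 2 := (mem_mon 2 g).mpr ⟨hg, h1⟩
      rw [mon, Finset.mem_image] at hgm
      obtain ⟨c, -, rfl⟩ := hgm
      have hC2 : (C (2 : F)) = 2 := rfl
      have e : (X ^ 2 + pol c) ^ 2 * 1 = X ^ 4 + pol ![c 0 ^ 2, 2 * c 0 * c 1, c 1 ^ 2 + 2 * c 0, 2 * c 1] := by
        simp [pol, Fin.sum_univ_four, Fin.sum_univ_two, hC2]
        ring
      rw [e, dep] at he
      have hp := pol_injective (add_left_cancel he)
      have e0 := congrFun hp 0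
      have e1 := congrFun hp 1
      have e2 := congrFun hp 2
      have e3 := congrFun hp 3
      simp only [Matrix.cons_val] at e0 e1 e2 e3
      have f1 : c 1 = 0 := by
        rcases mul_eq_zero.mp e3.symm with h | h
        · exact absurd h h2
        · exact h
      rw [f1] at e1 e2
      have f0 : c 0 = - (3 * X0) := mul_left_cancel₀ h2 (by linear_combination -e2)
      have fY : Y0 = 0 := by
        have : 2 * (2 * Y0) = 0 := by linear_combination e1
        simpa [h2] using this
      rw [f0] at e0
      refine ⟨X0, ?_, ?_⟩
      · rw [fY]; ring
      · linear_combination -e0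
  · rintro ⟨x, hx1, hx2⟩
    subst hx2
    by_cases hx : x = X0
    · subst hx
      have hY : Y0 ^ 2 = 0 := by linear_combination hx1
      have hY : Y0 = 0 := by simpa using hY
      subst hY
      refine ⟨X ^ 2 - C (3 * x), 1, ?_, monic_one, ?_, ?_⟩
      · exact monic_X_pow_sub_C _ (by norm_num)
      · rw [natDegree_X_pow_sub_C]; norm_num
      · rw [dep_eq]
        have h3 : (C (3 : F)) = 3 := rfl
        have h12 : (C (12 : F)) = 12 := rfl
        simp [h3, h12]
        ring
    · have hx0 : x - X0 ≠ 0 := sub_ne_zero.mpr hx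
      obtain ⟨y, hy⟩ : ∃ y, Y0 = - (2 * y * (x - X0)) := ⟨-Y0 / (2 * (x - X0)), by field_simp⟩
      have hX : X0 = y ^ 2 - 2 * x := by
        have : 4 * (x - X0) ^ 2 * (X0 - (y ^ 2 - 2 * x)) = 0 := by
          rw [hy] at hx1
          linear_combination -hx1
        have h4 : (4 : F) ≠ 0 := by
          have : (4 : F) = 2 * 2 := by norm_num
          rw [this]; exact mul_ne_zero h2 h2
        have := (mul_eq_zero.mp this).resolve_left (mul_ne_zero h4 (pow_ne_zero 2 hx0))
        linear_combination this
      clear hx1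
      subst hX
      subst hy
      have hQ : (X ^ 2 + C (2 * y) * X + C (6 * x - 3 * (y ^ 2 - 2 * x)) : F[X]) ∈ mon F 2 := by
        rw [mon, Finset.mem_image]
        refine ⟨![6 * x - 3 * (y ^ 2 - 2 * x), 2 * y], Finset.mem_univ _, ?_⟩
        simp [pol, Fin.sum_univ_two]
        ring
      rw [mem_mon] at hQ
      refine ⟨X - C y, _, monic_X_sub_C y, hQ.1, by rw [natDegree_X_sub_C], ?_⟩
      rw [dep_eq]
      have h3 : (C (3 : F)) = 3 := rfl
      have h2 : (C (2 : F)) = 2 := rfl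
      have h6 : (C (6 : F)) = 6 := rfl
      have h12 : (C (12 : F)) = 12 := rfl
      simp [h3, h12, h2, h6]
      ring

/-- character sum of the cubic -/
noncomputable def sf (g2 g3 : F) : ℤ := ∑ x : F, quadraticChar F (4 * x ^ 3 - g2 * x - g3)

lemma sum_affine (f : F → ℤ) (a b : F) (ha : a ≠ 0) : ∑ x, f (a * x + b) = ∑ x, f x :=
  Equiv.sum_comp ((Equiv.mulLeft₀ a ha).trans (Equiv.addRight b)) f

lemma sD_dep (hF : ringChar F ≠ 2) (X0 Y0 g2 : F) (hs : ¬ Sing g2 (4 * X0 ^ 3 - g2 * X0 - Y0 ^ 2)) :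
    sD (dep X0 Y0 g2) = sf g2 (4 * X0 ^ 3 - g2 * X0 - Y0 ^ 2) := by
  have h2 := two_ne hF
  have h4 : (4 : F) ≠ 0 := by
    have : (4 : F) = 2 * 2 := by norm_num
    rw [this]; exact mul_ne_zero h2 h2
  have hx : ∀ x : F, ∑ t : F, (if 4 * x ^ 2 * (t - X0) + 4 * x * Y0
        - (4 * t ^ 2 + 4 * t * X0 + 4 * X0 ^ 2 - g2) = 0 then (1 : ℤ) else 0)
      = chi (dep X0 Y0 g2) x + 1 := by
    intro x
    rw [chi, ← card_sq hF, ← sum_affine (fun T => if T ^ 2 = (dep X0 Y0 g2).eval x then (1 : ℤ) else 0)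
      2 (-(x ^ 2 - X0)) h2]
    apply Finset.sum_congr rfl
    intro t _
    congr 1
    rw [dep_eval, eq_iff_iff]
    constructor
    · intro h; linear_combination -h
    · intro h; linear_combination -h
  have ht : ∀ t ∈ univ.erase X0, ∑ x : F, (if 4 * x ^ 2 * (t - X0) + 4 * x * Y0
        - (4 * t ^ 2 + 4 * t * X0 + 4 * X0 ^ 2 - g2) = 0 then (1 : ℤ) else 0)
      = quadraticChar F (4 * t ^ 3 - g2 * t - (4 * X0 ^ 3 - g2 * X0 - Y0 ^ 2)) + 1 := by
    intro t ht
    have htX : t - X0 ≠ 0 := sub_ne_zero.mpr (Finset.mem_erase.mp ht).1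
    rw [← card_sq hF, ← sum_affine (fun T => if T ^ 2 = 4 * t ^ 3 - g2 * t - (4 * X0 ^ 3 - g2 * X0 - Y0 ^ 2)
      then (1 : ℤ) else 0) (2 * (t - X0)) Y0 (mul_ne_zero h2 htX)]
    apply Finset.sum_congr rfl
    intro x _
    congr 1
    rw [eq_iff_iff]
    constructor
    · intro h; linear_combination (t - X0) * h
    · intro h
      apply mul_left_cancel₀ htX
      linear_combination h
  have h0 : ∑ x : F, (if 4 * x ^ 2 * (X0 - X0) + 4 * x * Y0
        - (4 * X0 ^ 2 + 4 * X0 * X0 + 4 * X0 ^ 2 - g2) = 0 then (1 : ℤ) else 0)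
      = quadraticChar F (4 * X0 ^ 3 - g2 * X0 - (4 * X0 ^ 3 - g2 * X0 - Y0 ^ 2)) := by
    rw [show 4 * X0 ^ 3 - g2 * X0 - (4 * X0 ^ 3 - g2 * X0 - Y0 ^ 2) = Y0 ^ 2 by ring]
    by_cases hY : Y0 = 0
    · subst hY
      rw [Finset.sum_eq_zero]
      · simp
      · intro x _
        rw [if_neg]
        intro h
        apply hs
        exact ⟨X0, by ring, by linear_combination -h⟩
    · rw [quadraticChar_sq_one' hY]
      rw [Finset.sum_eq_single ((12 * X0 ^ 2 - g2) / (4 * Y0))]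
      · rw [if_pos]
        field_simp
        ring
      · intro b _ hb
        rw [if_neg]
        intro h
        apply hb
        field_simp
        linear_combination h
      · intro h; exact absurd (Finset.mem_univ _) h
  have hsum := Finset.sum_comm (s := (univ : Finset F)) (t := (univ : Finset F))
    (f := fun x t => if 4 * x ^ 2 * (t - X0) + 4 * x * Y0
        - (4 * t ^ 2 + 4 * t * X0 + 4 * X0 ^ 2 - g2) = 0 then (1 : ℤ) else 0)
  rw [Finset.sum_congr rfl (fun x _ => hx x)] at hsum
  have hR := Finset.add_sum_erase (univ : Finset F) (fun t => ∑ x : F,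
    if 4 * x ^ 2 * (t - X0) + 4 * x * Y0
        - (4 * t ^ 2 + 4 * t * X0 + 4 * X0 ^ 2 - g2) = 0 then (1 : ℤ) else 0) (Finset.mem_univ X0)
  rw [← hR, h0, Finset.sum_congr rfl ht,
    Finset.sum_add_distrib, Finset.sum_add_distrib] at hsum
  simp only [Finset.sum_const, nsmul_eq_mul, card_er, Finset.card_univ, mul_one] at hsum
  have hS := Finset.add_sum_erase (univ : Finset F) (fun t => quadraticChar F
    (4 * t ^ 3 - g2 * t - (4 * X0 ^ 3 - g2 * X0 - Y0 ^ 2))) (Finset.mem_univ X0)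
  rw [sD, sf]
  linarith

/-- moments over Weierstrass equations -/
noncomputable def ww (F : Type*) [Field F] [Fintype F] [DecidableEq F] (j : ℕ) : ℤ :=
  ∑ g2 : F, ∑ g3 : F, if Sing g2 g3 then 0 else sf g2 g3 ^ j

lemma mm_ww (hF : ringChar F ≠ 2) (h3 : (3 : F) ≠ 0) (q : ℤ) (hq : q = Fintype.card F) (j : ℕ) :
    mm F j = q * (q * ww F j + ww F (j + 1)) := by
  unfold mm
  rw [Finset.sum_filter, sum_qu hF h3]
  have h1 : ∀ e X0 Y0 g2 : F, (if Squarefree (qu e X0 Y0 g2) then sD (qu e X0 Y0 g2) ^ j else 0)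
      = if Sing g2 (4 * X0 ^ 3 - g2 * X0 - Y0 ^ 2) then 0 else
          sf g2 (4 * X0 ^ 3 - g2 * X0 - Y0 ^ 2) ^ j := by
    intro e X0 Y0 g2
    rw [sD_qu]
    by_cases h : Sing g2 (4 * X0 ^ 3 - g2 * X0 - Y0 ^ 2)
    · rw [if_pos h, if_neg]
      rw [sqf_qu]
      exact (sqf_dep hF X0 Y0 g2).mpr h
    · rw [if_neg h, if_pos, sD_dep hF X0 Y0 g2 h]
      rw [sqf_qu]
      by_contra h'
      exact h ((sqf_dep hF X0 Y0 g2).mp h')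
  simp_rw [h1]
  rw [Finset.sum_const, nsmul_eq_mul, Finset.card_univ, ← hq]
  congr 1
  have h2 : ∀ (g2 : F) (G : F → ℤ), ∑ X0 : F, ∑ Y0 : F, G (4 * X0 ^ 3 - g2 * X0 - Y0 ^ 2)
      = ∑ g3 : F, (q + sf g2 g3) * G g3 := by
    intro g2 G
    have h4 : ∀ X0 Y0 : F, G (4 * X0 ^ 3 - g2 * X0 - Y0 ^ 2)
        = ∑ g3 : F, (if Y0 ^ 2 = 4 * X0 ^ 3 - g2 * X0 - g3 then (1 : ℤ) else 0) * G g3 := by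
      intro X0 Y0
      rw [Finset.sum_eq_single (4 * X0 ^ 3 - g2 * X0 - Y0 ^ 2)]
      · rw [if_pos (by ring), one_mul]
      · intro b _ hb
        rw [if_neg, zero_mul]
        intro h
        apply hb
        linear_combination h
      · intro h; exact absurd (Finset.mem_univ _) h
    simp_rw [h4]
    simp_rw [Finset.sum_comm (s := (univ : Finset F)) (t := (univ : Finset F)) (f := fun Y0 g3 => (if Y0 ^ 2 = _ then (1 : ℤ) else 0) * G g3)]
    rw [Finset.sum_comm]
    apply Finset.sum_congr rfl
    intro g3 _
    simp_rw [← Finset.sum_mul, card_sq hF]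
    rw [Finset.sum_add_distrib, sf, hq, Finset.sum_const, nsmul_eq_mul, Finset.card_univ, mul_one]
    ring
  have h5 : ∑ X0 : F, ∑ Y0 : F, ∑ g2 : F, (if Sing g2 (4 * X0 ^ 3 - g2 * X0 - Y0 ^ 2) then 0 else
          sf g2 (4 * X0 ^ 3 - g2 * X0 - Y0 ^ 2) ^ j)
      = ∑ g2 : F, ∑ X0 : F, ∑ Y0 : F, (if Sing g2 (4 * X0 ^ 3 - g2 * X0 - Y0 ^ 2) then 0 else
          sf g2 (4 * X0 ^ 3 - g2 * X0 - Y0 ^ 2) ^ j) := by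
    rw [Finset.sum_congr rfl (fun X0 _ => Finset.sum_comm)]
    exact Finset.sum_comm
  rw [h5]
  simp_rw [fun g2 => h2 g2 (fun g3 => if Sing g2 g3 then 0 else sf g2 g3 ^ j)]
  unfold ww
  rw [Finset.mul_sum, ← Finset.sum_add_distrib]
  apply Finset.sum_congr rfl
  intro g2 _
  rw [Finset.mul_sum, ← Finset.sum_add_distrib]
  apply Finset.sum_congr rfl
  intro g3 _
  split_ifs
  · simp
  · ring

lemma sing_scale (u g2 g3 : F) (hu : u ≠ 0) : Sing (u ^ 2 * g2) (u ^ 3 * g3) ↔ Sing g2 g3 := by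
  constructor
  · rintro ⟨x, h1, h2⟩
    refine ⟨x / u, ?_, ?_⟩
    · field_simp
      linear_combination h1
    · field_simp
      linear_combination h2
  · rintro ⟨x, h1, h2⟩
    exact ⟨u * x, by linear_combination u ^ 3 * h1, by linear_combination u ^ 2 * h2⟩

lemma sf_scale (u g2 g3 : F) (hu : u ≠ 0) : sf (u ^ 2 * g2) (u ^ 3 * g3) = quadraticChar F u * sf g2 g3 := by
  unfold sf
  rw [← sum_affine _ u 0 hu, Finset.mul_sum]
  apply Finset.sum_congr rfl
  intro x _
  rw [← chi_cube u, ← map_pow, ← map_mul]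
  congr 1
  ring

lemma ww_odd (hF : ringChar F ≠ 2) (i : ℕ) : ww F (2 * i + 1) = 0 := by
  obtain ⟨u, hu⟩ := quadraticChar_exists_neg_one hF
  have hu0 : u ≠ 0 := by rintro rfl; simp at hu
  have : ww F (2 * i + 1) = - ww F (2 * i + 1) := by
    conv_lhs => rw [ww]
    rw [← sum_affine _ (u ^ 2) 0 (pow_ne_zero 2 hu0)]
    rw [ww, ← Finset.sum_neg_distrib]
    apply Finset.sum_congr rfl
    intro g2 _
    rw [← sum_affine _ (u ^ 3) 0 (pow_ne_zero 3 hu0), ← Finset.sum_neg_distrib]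
    apply Finset.sum_congr rfl
    intro g3 _
    simp only [add_zero, sing_scale u g2 g3 hu0, sf_scale u g2 g3 hu0, hu]
    split_ifs
    · simp
    · rw [neg_one_mul, Odd.neg_pow ⟨i, rfl⟩]
  linarith

lemma mm_even (hF : ringChar F ≠ 2) (h3 : (3 : F) ≠ 0) (q : ℤ) (hq : q = Fintype.card F) (i : ℕ) :
    mm F (2 * i + 2) = q * mm F (2 * i + 1) := by
  rw [mm_ww hF h3 q hq, mm_ww hF h3 q hq, ww_odd hF, show 2 * i + 2 + 1 = 2 * (i + 1) + 1 by ring, ww_odd hF]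
  ring

end transfer

section final

variable {F : Type*} [Field F] [Fintype F] [DecidableEq F]

lemma sum_four (Φ : F[X] → ℝ) :
    ∑ c : F × F × F × F, Φ (X ^ 4 + C c.1 * X ^ 3 + C c.2.1 * X ^ 2 + C c.2.2.1 * X + C c.2.2.2)
      = ∑ D ∈ mon F 4, Φ D := by
  rw [sum_mon]
  apply Fintype.sum_bijective (fun z : F × F × F × F => ![z.2.2.2, z.2.2.1, z.2.1, z.1])
  · rw [Fintype.bijective_iff_injective_and_card]
    constructor
    · rintro ⟨a, b, c, d⟩ ⟨a', b', c', d'⟩ h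
      have e0 := congrFun h 0
      have e1 := congrFun h 1
      have e2 := congrFun h 2
      have e3 := congrFun h 3
      simp only [Matrix.cons_val] at e0 e1 e2 e3
      rw [e0, e1, e2, e3]
    · simp; ring
  · rintro ⟨a, b, c, d⟩
    congr 1
    simp [pol, Fin.sum_univ_four]
    ring

lemma quadChar_eq (a : F) : quadChar F a = quadraticChar F a := by
  rw [quadraticChar_apply, quadraticCharFun, quadChar]
  congr

lemma aQ_eq (D : F[X]) : 1 - (aQ D : ℝ) = (sD D : ℝ) := by
  rw [sD, aQ]
  simp only [chi, quadChar_eq]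
  push_cast
  ring

lemma moment (w : ℝ) (k : ℕ) :
    ∑ D ∈ mon F 4, (if Squarefree D then (2 + (sD D : ℝ) * w) ^ k else 0)
      = ∑ i ∈ range (k + 1), w ^ i * 2 ^ (k - i) * (k.choose i : ℝ) * (mm F i : ℝ) := by
  rw [← Finset.sum_filter]
  unfold mm
  push_cast
  simp_rw [Finset.mul_sum]
  rw [Finset.sum_comm]
  apply Finset.sum_congr rfl
  intro D _
  rw [add_comm, add_pow]
  apply Finset.sum_congr rfl
  intro i _
  ring

end final

end QM


/-- The `d = 4` moment formula for `p > 3` prime and `1 ≤ k ≤ 8`, where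
`L(1/2,χ_D) = (1 − p^{-1/2})(2 + (1 − a_p(D)) p^{-1/2})` and monic squarefree quartics
are parametrized by their four non-leading coefficients. -/
theorem stmt_2 (p : ℕ) [Fact p.Prime] (hp : 3 < p) (k : ℕ) (hk1 : 1 ≤ k) (hk8 : k ≤ 8) :
    (1 / ((p : ℝ) ^ 4 - (p : ℝ) ^ 3)) *
      ∑ c : ZMod p × ZMod p × ZMod p × ZMod p,
        (if Squarefree
            (X ^ 4 + C c.1 * X ^ 3 + C c.2.1 * X ^ 2 + C c.2.2.1 * X + C c.2.2.2 :
              Polynomial (ZMod p)) then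
          ((1 - 1 / Real.sqrt p) *
            (2 + (1 - (aQ (X ^ 4 + C c.1 * X ^ 3 + C c.2.1 * X ^ 2 + C c.2.2.1 * X +
                C c.2.2.2 : Polynomial (ZMod p)) : ℝ)) / Real.sqrt p)) ^ k
        else 0)
    = (1 - 1 / Real.sqrt p) ^ k *
        (2 / ((k : ℝ) + 2) * (Nat.choose (2 * k + 1) k : ℝ)
          - 2 * ∑ l ∈ Finset.Icc 1 (k / 2),
              (Nat.choose (2 * k + 1) (k - 2 * l) : ℝ) * (2 * (l : ℝ) + 1) /
                (((k : ℝ) + 2 * (l : ℝ) + 2) * (p : ℝ) ^ (l + 1)))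
      + (1 - 1 / Real.sqrt p) ^ k * (1 / Real.sqrt p) *
        (4 / ((k : ℝ) + 3) * (Nat.choose (2 * k + 1) (k - 1) : ℝ)
          - 4 * ∑ l ∈ Finset.Icc 1 ((k + 1) / 2),
              ((k : ℝ) ^ 2 + (k : ℝ) + 4 * (l : ℝ) ^ 2 + 4 * (l : ℝ)) *
                (Nat.factorial (2 * k + 1) : ℝ) * (2 * (l : ℝ) + 1) /
                ((Nat.factorial (k + 2 * l + 3) : ℝ) *
                  (Nat.factorial (k + 1 - 2 * l) : ℝ) * (p : ℝ) ^ (l + 1))) := by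
  have hpp := (Fact.out : p.Prime)
  have hF : ringChar (ZMod p) ≠ 2 := by
    rw [ZMod.ringChar_zmod_n]; omega
  have h3 : (3 : ZMod p) ≠ 0 := by
    intro h
    have h' : ((3 : ℕ) : ZMod p) = 0 := by exact_mod_cast h
    rw [ZMod.natCast_eq_zero_iff] at h'
    have := Nat.le_of_dvd (by norm_num) h'
    omega
  have hq : (p : ℤ) = (Fintype.card (ZMod p) : ℤ) := by rw [ZMod.card]
  have hS := QM.sum_four (F := ZMod p) (fun D => if Squarefree D then
    ((1 - 1 / Real.sqrt p) * (2 + (1 - (aQ D : ℝ)) / Real.sqrt p)) ^ k else 0)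
  have hS2 : ∑ D ∈ QM.mon (ZMod p) 4, (if Squarefree D then
      ((1 - 1 / Real.sqrt p) * (2 + (1 - (aQ D : ℝ)) / Real.sqrt p)) ^ k else 0)
      = (1 - 1 / Real.sqrt p) ^ k * ∑ i ∈ range (k + 1), (1 / Real.sqrt p) ^ i * 2 ^ (k - i)
        * (k.choose i : ℝ) * (QM.mm (ZMod p) i : ℝ) := by
    rw [← QM.moment, Finset.mul_sum]
    apply Finset.sum_congr rfl
    intro D _
    split_ifs
    · rw [QM.aQ_eq, mul_pow, mul_one_div]
    · simp
  rw [hS, hS2]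
  have m0 := QM.mm_zero hF _ hq
  have m1 := QM.mm1 hF _ hq
  have m3 := QM.mm3 hF _ hq
  have m5 := QM.mm5 hF _ hq
  have m7 := QM.mm7 hF _ hq
  have m2 := QM.mm_even hF h3 _ hq 0
  have m4 := QM.mm_even hF h3 _ hq 1
  have m6 := QM.mm_even hF h3 _ hq 2
  have m8 := QM.mm_even hF h3 _ hq 3
  norm_num only at m2 m4 m6 m8
  rw [m1] at m2
  rw [m3] at m4
  rw [m5] at m6
  rw [m7] at m8
  clear hS hS2
  have hp0 : (0 : ℝ) < p := by exact_mod_cast hpp.pos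
  obtain ⟨t, ht⟩ : ∃ t, t = Real.sqrt p := ⟨_, rfl⟩
  have htp : (p : ℝ) = t ^ 2 := by rw [ht, Real.sq_sqrt hp0.le]
  have ht0 : t ≠ 0 := by rw [ht]; exact (Real.sqrt_pos.mpr hp0).ne'
  have ht1 : t ^ 2 - 1 ≠ 0 := by
    rw [← htp, sub_ne_zero]
    exact_mod_cast hpp.one_lt.ne'
  rw [← ht]
  generalize 1 - 1 / t = A
  have hd : (p : ℝ) ^ 4 - (p : ℝ) ^ 3 = t ^ 6 * (t ^ 2 - 1) := by rw [htp]; ring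
  rw [hd]
  have aux2 : ∀ B C D E : ℝ, B * C = D + 1 / t * E → B * (A ^ k * C) = A ^ k * D + A ^ k * (1 / t) * E := by
    intro B C D E h
    linear_combination A ^ k * h
  apply aux2
  clear aux2
  interval_cases k <;>
  · simp only [Finset.sum_range_succ, Finset.sum_range_zero, m0, m1, m2, m3, m4, m5, m6, m7, m8]
    norm_num [Finset.sum_Icc_succ_top, Nat.choose, Nat.factorial]
    rw [htp]
    field_simp
    ring
end

section
/- Let k and l be positive integers with 2l ≤ k+1. Then Σ_{ν even, 2l ≤ ν ≤ k+1} C(k, ν−1) · ν! · 2^{k−ν+1} / ((ν/2 − l)! · (ν/2 + l + 1)!) = 4·(k² + k + 4l² + 4l)·(2k+1)! / ((k+2l+3)! · (k−2l+1)!), where the sum is over even integers ν in the indicated range. -/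
open Finset

lemma trinom_aux (N d : ℕ) : ((2 * N).choose (N + d) : ℚ) =
    ∑ i ∈ range (N + 1), (N.choose i : ℚ) * ((N - i).choose (d + i) : ℚ) * 2 ^ (N - i - (d + i)) := by
  have h1 : ((1 + Polynomial.X : Polynomial ℚ) ^ (2 * N)) =
      ((Polynomial.X * (Polynomial.X + Polynomial.C 2)) + 1) ^ N := by
    rw [pow_mul]
    congr 1
    have : (Polynomial.C 2 : Polynomial ℚ) = 2 := rfl
    rw [this]; ring
  have h2 := congrArg (fun p => Polynomial.coeff p (N + d)) h1
  simp only [Polynomial.coeff_one_add_X_pow] at h2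
  rw [h2, add_pow, Polynomial.finsetSum_coeff, ← Finset.sum_range_reflect]
  apply Finset.sum_congr rfl
  intro i hi
  have hi' : i ≤ N := by simp at hi; omega
  have e : N + 1 - 1 - i = N - i := by omega
  rw [e, one_pow, mul_one, mul_pow, ← Polynomial.C_eq_natCast, Polynomial.coeff_mul_C,
    Polynomial.coeff_X_pow_mul', if_pos (by omega), Polynomial.coeff_X_add_C_pow,
    Nat.choose_symm hi']
  have e2 : N + d - (N - i) = d + i := by omega
  rw [e2]; ring

lemma choose_fac (a b : ℕ) : ((a + b).choose a : ℚ) =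
    ((a + b).factorial : ℚ) / ((a.factorial : ℚ) * (b.factorial : ℚ)) := by
  rw [Nat.cast_add_choose]

lemma term_aux (k l i a : ℕ) (hl : 0 < l) (h : 2 * l + 2 * i + a = k + 1) :
    (Nat.choose k (2 * (l + i) - 1) : ℚ) * (Nat.factorial (2 * (l + i)) : ℚ) * 2 ^ a /
          ((Nat.factorial i : ℚ) * (Nat.factorial (l + i + l + 1) : ℚ))
    = (((k + 2).choose i : ℚ) * ((k + 2 - i).choose (2 * l + 1 + i) : ℚ)
          * 2 ^ (k + 2 - i - (2 * l + 1 + i))) / (k + 2)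
      - 2 * (((k + 1).choose i : ℚ) * ((k + 1 - i).choose (2 * l + 1 + i) : ℚ)
          * 2 ^ (k + 1 - i - (2 * l + 1 + i))) / (k + 1) := by
  obtain ⟨l, rfl⟩ : ∃ m, l = m + 1 := ⟨l - 1, by omega⟩
  obtain rfl : k = (2 * (l + i) + 1) + a := by omega
  have e1 : 2 * (l + 1 + i) - 1 = 2 * (l + i) + 1 := by omega
  have e2 : 2 * (l + 1 + i) = 2 * (l + i) + 1 + 1 := by omega
  have e3 : 2 * (l + i) + 1 + a + 2 - i = (2 * (l + 1) + 1 + i) + a := by omega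
  have e4 : 2 * (l + i) + 1 + a + 2 - i - (2 * (l + 1) + 1 + i) = a := by omega
  have e5 : 2 * (l + i) + 1 + a + 2 = i + ((2 * (l + 1) + 1 + i) + a) := by omega
  have e6 : l + 1 + i + (l + 1) + 1 = 2 * (l + 1) + 1 + i := by omega
  have f0 : ((2 * (l + i) + 1 + a + 2).factorial : ℚ)
    = (2 * (l + i) + 1 + a + 2) * (2 * (l + i) + 1 + a + 1) * (2 * (l + i) + 1 + a).factorial := by
    rw [Nat.factorial_succ, Nat.factorial_succ]; push_cast; ring
  have g1 : ((2 * (l + i) + 1 + a + 2).choose i : ℚ) = ((2 * (l + i) + 1 + a + 2).factorial : ℚ) /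
      ((i.factorial : ℚ) * (((2 * (l + 1) + 1 + i) + a).factorial : ℚ)) := by
    rw [e5, choose_fac]
  rw [e4, g1, e3, e1, choose_fac, choose_fac, e6, e2, Nat.factorial_succ (2 * (l + i) + 1), f0]
  have p1 : (2 * (l + i) + 1 + a + 2 : ℚ) ≠ 0 := by positivity
  have p2 : (2 * (l + i) + 1 + a + 1 : ℚ) ≠ 0 := by positivity
  have q (n : ℕ) : (n.factorial : ℚ) ≠ 0 := by positivity
  have q1 := q (2 * (l + i) + 1)
  have q2 := q (2 * (l + i) + 1 + a)
  have q3 := q i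
  have q4 := q (2 * (l + 1) + 1 + i)
  have q5 := q (2 * (l + 1) + 1 + i + a)
  rcases a with _ | a
  · have z : (2 * (l + i) + 1 + 0 + 1 - i).choose (2 * (l + 1) + 1 + i) = 0 :=
      Nat.choose_eq_zero_of_lt (by omega)
    rw [z]
    push_cast at *
    generalize ((2 * (l + i) + 1).factorial : ℚ) = A at *
    field_simp
    simp
    ring_nf at *
    try field_simp
  · have g2 : ((2 * (l + i) + 1 + (a + 1) + 1).choose i : ℚ)
        = ((2 * (l + i) + 1 + (a + 1) + 1).factorial : ℚ) /
      ((i.factorial : ℚ) * (((2 * (l + 1) + 1 + i) + a).factorial : ℚ)) := by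
      have : 2 * (l + i) + 1 + (a + 1) + 1 = i + ((2 * (l + 1) + 1 + i) + a) := by omega
      rw [this, choose_fac]
    have e7 : 2 * (l + i) + 1 + (a + 1) + 1 - i = (2 * (l + 1) + 1 + i) + a := by omega
    rw [g2, e7, choose_fac, Nat.factorial_succ (2 * (l + i) + 1 + (a + 1)),
      Nat.factorial_succ a, Nat.add_sub_cancel_left]
    have q6 := q (2 * (l + 1) + 1 + i + a)
    have q7 := q a
    generalize ((2 * (l + i) + 1).factorial) = A at *
    generalize ((2 * (l + i) + 1 + (a + 1)).factorial) = B at *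
    generalize ((2 * (l + 1) + 1 + i + a).factorial) = C at *
    generalize ((2 * (l + 1) + 1 + i + (a + 1)).factorial) = D at *
    generalize ((2 * (l + 1) + 1 + i).factorial) = E at *
    push_cast at *
    field_simp
    ring

lemma rhs_aux (k l : ℕ) (hlk : 2 * l ≤ k + 1) :
    ((2 * (k + 2)).choose (k + 2 + (2 * l + 1)) : ℚ) / (k + 2)
      - 2 * ((2 * (k + 1)).choose (k + 1 + (2 * l + 1)) : ℚ) / (k + 1)
    = 4 * ((k : ℚ) ^ 2 + (k : ℚ) + 4 * (l : ℚ) ^ 2 + 4 * (l : ℚ)) *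
        (Nat.factorial (2 * k + 1) : ℚ) /
        ((Nat.factorial (k + 2 * l + 3) : ℚ) * (Nat.factorial (k + 1 - 2 * l) : ℚ)) := by
  obtain ⟨c, hc⟩ : ∃ c, k + 1 = 2 * l + c := ⟨k + 1 - 2 * l, by omega⟩
  have e1 : k + 1 - 2 * l = c := by omega
  have hcq : (k : ℚ) = 2 * l + c - 1 := by
    have : ((k + 1 : ℕ) : ℚ) = ((2 * l + c : ℕ) : ℚ) := by rw [hc]
    push_cast at this; linarith
  have g1 : ((2 * (k + 2)).choose (k + 2 + (2 * l + 1)) : ℚ) =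
      ((2 * k + 1 + 1 + 1 + 1).factorial : ℚ) / (((k + 2 * l + 3).factorial : ℚ) * (c.factorial : ℚ)) := by
    have h1 : 2 * (k + 2) = (k + 2 * l + 3) + c := by omega
    have h2 : k + 2 + (2 * l + 1) = k + 2 * l + 3 := by omega
    have h3 : 2 * k + 1 + 1 + 1 + 1 = (k + 2 * l + 3) + c := by omega
    rw [h1, h2, h3, choose_fac]
  have p1 : (k + 2 : ℚ) ≠ 0 := by positivity
  have p2 : (k + 1 : ℚ) ≠ 0 := by positivity
  have q (n : ℕ) : (n.factorial : ℚ) ≠ 0 := by positivity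
  have q1 := q (2 * k + 1)
  have q2 := q (k + 2 * l + 2)
  have q3 := q c
  have p3 : (k + 2 * l + 2 + 1 : ℚ) ≠ 0 := by positivity
  rw [e1, g1, Nat.factorial_succ (k + 2 * l + 2), Nat.factorial_succ (2 * k + 1 + 1 + 1),
    Nat.factorial_succ (2 * k + 1 + 1), Nat.factorial_succ (2 * k + 1)]
  rcases c with _ | c
  · rw [Nat.choose_eq_zero_of_lt (by omega : 2 * (k + 1) < k + 1 + (2 * l + 1))]
    have : (l : ℚ) = (k + 1) / 2 := by rw [hcq]; push_cast; ring
    clear hcq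
    generalize ((2 * k + 1).factorial) = A at *
    generalize ((k + 2 * l + 2).factorial) = B at *
    push_cast at *
    field_simp
    rw [this]
    ring
  · have g2 : ((2 * (k + 1)).choose (k + 1 + (2 * l + 1)) : ℚ) =
      ((2 * k + 1 + 1).factorial : ℚ) / (((k + 2 * l + 2).factorial : ℚ) * (c.factorial : ℚ)) := by
      have h1 : 2 * (k + 1) = (k + 2 * l + 2) + c := by omega
      have h2 : k + 1 + (2 * l + 1) = k + 2 * l + 2 := by omega
      have h3 : 2 * k + 1 + 1 = (k + 2 * l + 2) + c := by omega
      rw [h1, h2, h3, choose_fac]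
    have q4 := q c
    rw [g2, Nat.factorial_succ c, Nat.factorial_succ (2 * k + 1)]
    have : (c : ℚ) = k - 2 * l := by rw [hcq]; push_cast; ring
    clear hcq
    have p4 : (c + 1 : ℚ) ≠ 0 := by positivity
    generalize ((2 * k + 1).factorial) = A at *
    generalize ((k + 2 * l + 2).factorial) = B at *
    generalize (c.factorial) = C at *
    push_cast at *
    field_simp
    rw [this]
    ring

/-- Lemma 7.4 (binomial identity): for positive integers `k, l` with `2l ≤ k + 1`,
`Σ_{ν even, 2l ≤ ν ≤ k+1} C(k,ν−1)·ν!·2^{k−ν+1}/((ν/2−l)!·(ν/2+l+1)!)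
  = 4(k²+k+4l²+4l)(2k+1)!/((k+2l+3)!(k−2l+1)!)`. -/
theorem stmt_3 (k l : ℕ) (hk : 0 < k) (hl : 0 < l) (hlk : 2 * l ≤ k + 1) :
    ∑ ν ∈ (Finset.Icc (2 * l) (k + 1)).filter (fun ν => Even ν),
        (Nat.choose k (ν - 1) : ℚ) * (Nat.factorial ν : ℚ) * 2 ^ (k + 1 - ν) /
          ((Nat.factorial (ν / 2 - l) : ℚ) * (Nat.factorial (ν / 2 + l + 1) : ℚ))
    = 4 * ((k : ℚ) ^ 2 + (k : ℚ) + 4 * (l : ℚ) ^ 2 + 4 * (l : ℚ)) *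
        (Nat.factorial (2 * k + 1) : ℚ) /
        ((Nat.factorial (k + 2 * l + 3) : ℚ) * (Nat.factorial (k + 1 - 2 * l) : ℚ)) := by
  rw [← rhs_aux k l hlk]
  have t2 := trinom_aux (k + 1) (2 * l + 1)
  have t2' : ((2 * (k + 1)).choose (k + 1 + (2 * l + 1)) : ℚ) =
    ∑ i ∈ range (k + 2 + 1), ((k + 1).choose i : ℚ) * ((k + 1 - i).choose (2 * l + 1 + i) : ℚ)
      * 2 ^ (k + 1 - i - (2 * l + 1 + i)) := by
    rw [t2, Finset.sum_range_succ _ (k + 2), Nat.choose_succ_self]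
    simp
  rw [trinom_aux (k + 2) (2 * l + 1), t2', Finset.mul_sum, Finset.sum_div, Finset.sum_div,
    ← Finset.sum_sub_distrib]
  have hs : (range (k + 2 + 1)).filter (fun i => 2 * l + 2 * i ≤ k + 1) ⊆ range (k + 2 + 1) :=
    Finset.filter_subset _ _
  rw [← Finset.sum_subset hs]
  · refine Finset.sum_nbij' (fun ν => ν / 2 - l) (fun i => 2 * (l + i)) ?_ ?_ ?_ ?_ ?_
    · intro ν hν
      simp only [mem_filter, mem_Icc, mem_range] at hν ⊢
      omega
    · intro i hi
      simp only [mem_filter, mem_Icc, mem_range] at hi ⊢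
      exact ⟨by omega, even_two_mul _⟩
    · intro ν hν
      simp only [mem_filter, mem_Icc] at hν
      obtain ⟨h, m, rfl⟩ := hν
      omega
    · intro i hi
      omega
    · intro ν hν
      simp only [mem_filter, mem_Icc] at hν
      obtain ⟨h, m, rfl⟩ := hν
      obtain ⟨i, rfl⟩ : ∃ i, m = l + i := ⟨m - l, by omega⟩
      have e1 : (l + i + (l + i)) / 2 = l + i := by omega
      have e2 : l + i + (l + i) = 2 * (l + i) := by omega
      have e3 : l + i - l = i := by omega
      simp only [e1, e3]
      rw [e2]
      exact term_aux k l i _ hl (by omega)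
  · intro i _ hi
    have hi' : k + 1 < 2 * l + 2 * i := by
      by_contra hc
      apply hi
      simp only [mem_filter, mem_range]
      omega
    rw [Nat.choose_eq_zero_of_lt (by omega : k + 2 - i < 2 * l + 1 + i),
      Nat.choose_eq_zero_of_lt (by omega : k + 1 - i < 2 * l + 1 + i)]
    simp
end

section
/- For every nonnegative integer k, Σ_{j even, 0 ≤ j ≤ k} C(k, j) · j! · 2^{k−j} / ((j/2)! · (j/2 + 1)!) = (2/(k+2)) · C(2k+1, k), where the sum is over even integers j in the indicated range. -/
open Finset

/-- Catalan-like factor. -/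
def cc (i : ℕ) : ℚ := (Nat.factorial (2*i) : ℚ) / ((Nat.factorial i : ℚ) * (Nat.factorial (i+1) : ℚ))

/-- Summand. -/
def FF (k i : ℕ) : ℚ := (Nat.choose k (2*i) : ℚ) * cc i * 2 ^ k / 4 ^ i

lemma cc_succ (i : ℕ) : cc (i+1) = 2 * (2 * i + 1) * cc i / (i + 2) := by
  unfold cc
  have h1 : (Nat.factorial i : ℚ) ≠ 0 := by positivity
  have h3 : (i : ℚ) + 2 ≠ 0 := by positivity
  have h4 : (i : ℚ) + 1 ≠ 0 := by positivity
  have h5 : (i : ℚ) + 1 + 1 ≠ 0 := by positivity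
  rw [show 2 * (i+1) = 2*i+1+1 by ring]
  simp only [Nat.factorial_succ]
  push_cast
  field_simp
  ring

lemma ch_succ (k j : ℕ) : (Nat.choose k (j+1) : ℚ) = Nat.choose k j * ((k:ℚ) - j) / (j+1) := by
  have h4 : (j : ℚ) + 1 ≠ 0 := by positivity
  rw [eq_div_iff h4]
  have h := Nat.choose_succ_right_eq k j
  rcases le_or_gt j k with hjk | hjk
  · rw [← Nat.cast_sub hjk]; exact_mod_cast h
  · rw [Nat.choose_eq_zero_of_lt hjk, Nat.choose_eq_zero_of_lt (by omega : k < j + 1)]; simp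

lemma tele (k n : ℕ) : ∑ i ∈ range (n+1), (((k:ℚ)+3) * FF (k+1) i - 2*(2*k+3) * FF k i)
    = -2 * ((k:ℚ) - 2*n) * FF k n := by
  induction n with
  | zero => simp [FF, cc]; ring
  | succ n ih =>
    rw [sum_range_succ, ih]
    unfold FF
    rw [show 2 * (n+1) = 2*n+1+1 by ring, Nat.choose_succ_succ k, cc_succ]
    push_cast
    rw [ch_succ k (2*n+1), ch_succ k (2*n)]
    push_cast
    have h3 : (n : ℚ) + 2 ≠ 0 := by positivity
    have h4 : (2 * n : ℚ) + 1 + 1 ≠ 0 := by positivity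
    have h5 : (2 * n : ℚ) + 1 ≠ 0 := by positivity
    field_simp
    ring

lemma FF_zero {k i : ℕ} (h : k < 2 * i) : FF k i = 0 := by
  simp [FF, Nat.choose_eq_zero_of_lt h]

lemma sum_FF (k : ℕ) : ∑ i ∈ range (k+1), FF k i = 2 / ((k : ℚ) + 2) * (Nat.choose (2 * k + 1) k : ℚ) := by
  induction k with
  | zero => simp [FF, cc]
  | succ k ih =>
    have h := tele k (k+1)
    rw [FF_zero (by omega : k < 2 * (k+1)), sum_sub_distrib, ← mul_sum, ← mul_sum,
      sum_range_succ (FF k), FF_zero (by omega : k < 2 * (k+1)), ih] at h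
    have e : (Nat.choose (2*(k+1)+1) (k+1) : ℚ) * (k+2) = 2 * (2*k+3) * Nat.choose (2*k+1) k := by
      have a1 := Nat.add_one_mul_choose_eq (2*k+2) k
      have a2 := Nat.choose_succ_right_eq (2*k+1) k
      have a3 := Nat.choose_succ_succ (2*k+1) k
      have a4 := Nat.choose_succ_right_eq (2*k+2) k
      have a5 := Nat.choose_succ_succ (2*k+2) k
      rw [show 2*k+1-k = k+1 by omega] at a2
      rw [show 2*k+2-k = k+2 by omega] at a4
      have a2' := Nat.eq_of_mul_eq_mul_right (Nat.succ_pos k) a2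
      have a3' : (2*k+2).choose (k+1) = (2*k+1).choose k + (2*k+1).choose (k+1) := a3
      have a5' : (2*(k+1)+1).choose (k+1) = (2*k+2).choose k + (2*k+2).choose (k+1) := a5
      rw [a2'] at a3'
      rw [a3'] at a4 a5'
      rw [a5']
      qify at a4
      push_cast
      linarith
    have h2 : (k : ℚ) + 2 ≠ 0 := by positivity
    have h3 : (k : ℚ) + 3 ≠ 0 := by positivity
    have e' := (eq_div_iff h2).2 e
    rw [e']
    push_cast
    rw [show (k:ℚ)+1+2 = k+3 by ring]
    apply mul_left_cancel₀ h3
    have : ((k:ℚ)+3) * ∑ i ∈ range (k+1+1), FF (k+1) i = 2*(2*k+3) * (2 / ((k : ℚ) + 2) * (Nat.choose (2 * k + 1) k : ℚ)) := by linarith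
    rw [this]
    field_simp

/-- For every `k ≥ 0`,
`Σ_{j even, 0 ≤ j ≤ k} C(k,j)·j!·2^{k−j}/((j/2)!·(j/2+1)!) = (2/(k+2))·C(2k+1,k)`. -/
theorem stmt_4 (k : ℕ) :
    ∑ j ∈ (Finset.range (k + 1)).filter (fun j => Even j),
        (Nat.choose k j : ℚ) * (Nat.factorial j : ℚ) * 2 ^ (k - j) /
          ((Nat.factorial (j / 2) : ℚ) * (Nat.factorial (j / 2 + 1) : ℚ))
    = 2 / ((k : ℚ) + 2) * (Nat.choose (2 * k + 1) k : ℚ) := by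
  rw [← sum_FF]
  symm
  have hs : (range (k+1)).filter (fun i => 2 * i ≤ k) ⊆ range (k+1) := filter_subset _ _
  rw [← sum_subset hs (fun x hx hn => FF_zero (by
    simp only [mem_filter, not_and, not_le] at hn; exact hn hx))]
  refine sum_bij' (fun i _ => 2 * i) (fun j _ => j / 2) ?_ ?_ ?_ ?_ ?_
  · intro i hi
    simp only [mem_filter, mem_range] at hi ⊢
    exact ⟨by omega, even_two_mul i⟩
  · intro j hj
    simp only [mem_filter, mem_range] at hj ⊢
    omega
  · intro i hi
    simp
  · intro j hj
    simp only [mem_filter] at hj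
    exact Nat.two_mul_div_two_of_even hj.2
  · intro i hi
    simp only [mem_filter, mem_range] at hi
    have hp : (2:ℚ)^k = 2^(k-2*i) * 4^i := by
      rw [show (4:ℚ) = 2^2 by norm_num, ← pow_mul, ← pow_add]
      congr 1; omega
    have : 2 * i / 2 = i := by omega
    simp only [this, FF, cc, hp]
    field_simp
end

section
/- Let k and l be nonnegative integers with 2l ≤ k. Then Σ_{j even, 2l ≤ j ≤ k} C(k, j) · j! · 2^{k−j} / ((j/2 − l)! · (j/2 + l + 1)!) = (2/(k+2l+2)) · C(2k+1, k−2l), where the sum is over even integers j in the indicated range. -/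
open Finset

open Polynomial in
lemma coeff_aux (k l : ℕ) (hlk : 2 * l ≤ k) :
    (Nat.choose (2 * k + 2) (k - 2 * l) : ℚ) =
    ∑ j ∈ Finset.range (k + 1), if 2 * l ≤ j ∧ Even j then
      (Nat.choose (j + 1) (j / 2 - l) : ℚ) * 2 ^ (k - j) * (Nat.choose (k + 1) (j + 1) : ℚ) else 0 := by
  have h1 : ((1 + X : ℚ[X]) ^ (2 * k + 2)) =
      ∑ i ∈ Finset.range (k + 1 + 1),
        (C ((2 : ℚ) ^ (k + 1 - i) * (Nat.choose (k + 1) i : ℚ)) *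
          expand ℚ 2 ((1 + X) ^ i)) * X ^ (k + 1 - i) := by
    have : (1 + X : ℚ[X]) ^ (2 * k + 2) = ((1 + X ^ 2) + C 2 * X) ^ (k + 1) := by
      rw [show 2 * k + 2 = 2 * (k + 1) by ring, pow_mul]
      congr 1
      rw [show (C 2 : ℚ[X]) = 2 from rfl]
      ring
    rw [this, add_pow]
    refine Finset.sum_congr rfl fun i _ => ?_
    simp only [map_mul, map_pow, map_add, map_one, expand_X, map_natCast, mul_pow]
    ring
  have h2 := congrArg (fun p => p.coeff (k - 2 * l)) h1
  simp only [finset_sum_coeff, coeff_one_add_X_pow, coeff_mul_X_pow', coeff_C_mul,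
    coeff_expand (show 0 < 2 by norm_num)] at h2
  rw [h2, Finset.sum_range_succ']
  rw [if_neg (by omega), add_zero]
  refine Finset.sum_congr rfl fun j hj => ?_
  have hj' : j ≤ k := by simpa [Nat.lt_succ_iff] using hj
  by_cases h : 2 * l ≤ j
  · rw [if_pos (by omega)]
    have e : k - 2 * l - (k + 1 - (j + 1)) = j - 2 * l := by omega
    rw [e]
    by_cases hE : Even j
    · obtain ⟨r, rfl⟩ := hE
      rw [if_pos (by omega), if_pos ⟨h, ⟨r, rfl⟩⟩,
        show (r + r - 2 * l) / 2 = (r + r) / 2 - l by omega,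
        show k + 1 - (r + r + 1) = k - (r + r) by omega]
      ring
    · rw [if_neg (fun hd => hE (by rw [even_iff_two_dvd]; omega)), if_neg (fun h => hE h.2), mul_zero]
  · rw [if_neg (by omega), if_neg (fun h' => h h'.1)]

/-- For nonnegative integers `k, l` with `2l ≤ k`,
`Σ_{j even, 2l ≤ j ≤ k} C(k,j)·j!·2^{k−j}/((j/2−l)!·(j/2+l+1)!)
  = (2/(k+2l+2))·C(2k+1,k−2l)`. -/
theorem stmt_5 (k l : ℕ) (hlk : 2 * l ≤ k) :
    ∑ j ∈ (Finset.Icc (2 * l) k).filter (fun j => Even j),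
        (Nat.choose k j : ℚ) * (Nat.factorial j : ℚ) * 2 ^ (k - j) /
          ((Nat.factorial (j / 2 - l) : ℚ) * (Nat.factorial (j / 2 + l + 1) : ℚ))
    = 2 / ((k : ℚ) + 2 * (l : ℚ) + 2) * (Nat.choose (2 * k + 1) (k - 2 * l) : ℚ) := by
  have hk : ((k : ℚ) + 1) ≠ 0 := by positivity
  have hkl : ((k : ℚ) + 2 * l + 2) ≠ 0 := by positivity
  have hR : 2 / ((k : ℚ) + 2 * (l : ℚ) + 2) * (Nat.choose (2 * k + 1) (k - 2 * l) : ℚ)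
      = (Nat.choose (2 * k + 2) (k - 2 * l) : ℚ) / (k + 1) := by
    have := Nat.choose_mul_succ_eq (2 * k + 1) (k - 2 * l)
    rw [show 2 * k + 1 + 1 - (k - 2 * l) = k + 2 * l + 2 by omega] at this
    have h' : ((2 * k + 1).choose (k - 2 * l) : ℚ) * (2 * k + 1 + 1)
      = (2 * k + 2).choose (k - 2 * l) * (k + 2 * l + 2) := by exact_mod_cast this
    field_simp
    linarith
  rw [hR, coeff_aux k l hlk, eq_div_iff hk, Finset.sum_mul, ← Finset.sum_filter]
  have hs : (Finset.Icc (2 * l) k).filter (fun j => Even j)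
      = (Finset.range (k + 1)).filter (fun j => 2 * l ≤ j ∧ Even j) := by
    ext j
    simp only [Finset.mem_filter, Finset.mem_Icc, Finset.mem_range, Nat.lt_succ_iff]
    tauto
  rw [hs]
  refine Finset.sum_congr rfl fun j hj => ?_
  obtain ⟨_, h, r, rfl⟩ := Finset.mem_filter.1 hj
  obtain ⟨s, rfl⟩ : ∃ s, r = l + s := ⟨r - l, by omega⟩
  rw [show (l + s + (l + s)) / 2 = l + s by omega, show l + s - l = s by omega]
  have h1 := Nat.add_one_mul_choose_eq k (l + s + (l + s))
  have h1' : ((k : ℚ) + 1) * (k.choose (l + s + (l + s)))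
    = (k + 1).choose (l + s + (l + s) + 1) * ((l + s + (l + s) : ℕ) + 1) := by exact_mod_cast h1
  have h2 := Nat.choose_mul_factorial_mul_factorial (show s ≤ l + s + (l + s) + 1 by omega)
  rw [show l + s + (l + s) + 1 - s = l + s + l + 1 by omega,
    Nat.factorial_succ (l + s + (l + s))] at h2
  have h2' : ((l + s + (l + s) + 1).choose s : ℚ) * (s.factorial : ℚ) * ((l + s + l + 1).factorial : ℚ)
    = ((l + s + (l + s) : ℕ) + 1) * ((l + s + (l + s)).factorial : ℚ) := by exact_mod_cast h2
  have f1 : (s.factorial : ℚ) ≠ 0 := by exact_mod_cast s.factorial_ne_zero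
  have f2 : ((l + s + l + 1).factorial : ℚ) ≠ 0 := by exact_mod_cast (l + s + l + 1).factorial_ne_zero
  rw [div_mul_eq_mul_div, div_eq_iff (mul_ne_zero f1 f2)]
  generalize (2 : ℚ) ^ (k - (l + s + (l + s))) = P
  generalize ((l + s + (l + s) : ℕ) : ℚ) = J at *
  linear_combination ((l + s + (l + s)).factorial : ℚ) * P * h1' - P * ((k + 1).choose (l + s + (l + s) + 1) : ℚ) * h2'
end

section
/- Let F_q be a finite field of odd characteristic greater than 3. Let A, B, C ∈ F_q be such that the quartic polynomial x⁴ + Ax² + Bx + C ∈ F_q[x] is squarefree, and set α := −C/4 − A²/48 and β := A³/864 + B²/64 − A·C/24. Then Σ_{X∈F_q} χ(X³ + αX + β) = 1 + Σ_{x∈F_q} χ(x⁴ + Ax² + Bx + C); equivalently, the affine curve Y² = X³ + αX + β has exactly one more F_q-point than the affine curve y² = x⁴ + Ax² + Bx + C. -/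
open Polynomial Finset
open scoped Classical

theorem card_sq_aux (F : Type*) [Field F] [Fintype F] (h2 : ringChar F ≠ 2) (a : F) :
    ((univ.filter (fun y : F => y ^ 2 = a)).card : ℤ) = 1 + quadChar F a := by
  have h := quadraticChar_card_sqrts h2 a
  have e : quadraticChar F a = quadChar F a := by
    rw [quadraticChar_apply, quadraticCharFun, quadChar]
    congr
  rw [e] at h
  rw [add_comm, ← h]
  congr 2
  ext y
  simp

theorem card_t_aux (F : Type*) [Field F] [Fintype F] (h2 : ringChar F ≠ 2) (A B D x : F) :
    ((univ.filter (fun t : F => (2 * t + A) * x ^ 2 + B * x + D - t ^ 2 = 0)).card : ℤ)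
      = 1 + quadChar F (x ^ 4 + A * x ^ 2 + B * x + D) := by
  rw [← card_sq_aux F h2]
  congr 1
  refine Finset.card_bij' (fun t _ => t - x ^ 2) (fun y _ => y + x ^ 2) ?_ ?_ ?_ ?_
  · intro t ht
    simp only [mem_filter, mem_univ, true_and] at ht ⊢
    linear_combination -ht
  · intro t ht
    simp only [mem_filter, mem_univ, true_and] at ht ⊢
    linear_combination -ht
  · intro t _; ring
  · intro t _; ring

theorem card_x_aux (F : Type*) [Field F] [Fintype F] (h2 : ringChar F ≠ 2) (c B e : F)
    (hc : c ≠ 0) :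
    ((univ.filter (fun x : F => c * x ^ 2 + B * x + e = 0)).card : ℤ)
      = 1 + quadChar F (B ^ 2 - 4 * c * e) := by
  have h2' : (2 : F) ≠ 0 := Ring.two_ne_zero h2
  rw [← card_sq_aux F h2]
  congr 1
  refine Finset.card_bij' (fun x _ => 2 * c * x + B) (fun y _ => (y - B) / (2 * c)) ?_ ?_ ?_ ?_
  · intro t ht
    simp only [mem_filter, mem_univ, true_and] at ht ⊢
    linear_combination 4 * c * ht
  · intro t ht
    simp only [mem_filter, mem_univ, true_and] at ht ⊢
    field_simp
    linear_combination ht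
  · intro t _; field_simp; ring
  · intro t _; field_simp; ring

theorem stmt_11 (F : Type*) [Field F] [Fintype F] (hchar : 3 < ringChar F)
    (A B C₀ : F)
    (hsf : Squarefree (X ^ 4 + C A * X ^ 2 + C B * X + C C₀ : Polynomial F))
    (α β : F) (hα : α = -C₀ / 4 - A ^ 2 / 48)
    (hβ : β = A ^ 3 / 864 + B ^ 2 / 64 - A * C₀ / 24) :
    ∑ x : F, quadChar F (x ^ 3 + α * x + β)
      = 1 + ∑ x : F, quadChar F (x ^ 4 + A * x ^ 2 + B * x + C₀) := by
  have h2 : ringChar F ≠ 2 := by omega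
  have h2' : (2 : F) ≠ 0 := Ring.two_ne_zero h2
  have h3' : (3 : F) ≠ 0 := by
    intro h
    have : ringChar F ∣ 3 := (ringChar.spec F 3).1 (by exact_mod_cast h)
    have := Nat.le_of_dvd (by norm_num) this
    omega
  -- the cubic in t
  have hcub : ∑ x : F, quadChar F (x ^ 3 + α * x + β)
      = ∑ t : F, quadChar F (B ^ 2 - 4 * (2 * t + A) * (C₀ - t ^ 2)) := by
    refine Fintype.sum_equiv
      ⟨fun x => 2 * x - A / 6, fun t => (t + A / 6) / 2, fun x => by field_simp; ring,
        fun t => by field_simp; ring⟩ _ _ ?_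
    intro x
    have h6 : (6 : F) ≠ 0 := by
      have : (6 : F) = 2 * 3 := by norm_num
      rw [this]; exact mul_ne_zero h2' h3'
    have e4 : (4 : F) = 2 ^ 2 := by norm_num
    have e48 : (48 : F) = 2 ^ 4 * 3 := by norm_num
    have e864 : (864 : F) = 2 ^ 5 * 3 ^ 3 := by norm_num
    have e64 : (64 : F) = 2 ^ 6 := by norm_num
    have e24 : (24 : F) = 2 ^ 3 * 3 := by norm_num
    have e6 : (6 : F) = 2 * 3 := by norm_num
    have key : B ^ 2 - 4 * (2 * (2 * x - A / 6) + A) * (C₀ - (2 * x - A / 6) ^ 2)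
        = (x ^ 3 + α * x + β) * 8 ^ 2 := by
      rw [hα, hβ, e48, e864, e64, e24, e6, e4]
      field_simp
      ring
    have h8 : (8 : F) ≠ 0 := by
      have : (8 : F) = 2 ^ 3 := by norm_num
      rw [this]; exact pow_ne_zero _ h2'
    show quadChar F _ = quadChar F (B ^ 2 - 4 * (2 * (2 * x - A / 6) + A) * (C₀ - (2 * x - A / 6) ^ 2))
    rw [key]
    generalize x ^ 3 + α * x + β = w
    have hs : IsSquare (w * 8 ^ 2) ↔ IsSquare w := by
      constructor
      · rintro ⟨r, hr⟩
        exact ⟨r / 8, by field_simp; linear_combination hr⟩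
      · rintro ⟨r, hr⟩
        exact ⟨r * 8, by rw [hr]; ring⟩
    simp only [quadChar, hs, mul_eq_zero, pow_eq_zero_iff, h8, or_false, ne_eq,
      OfNat.ofNat_ne_zero, not_false_eq_true]
    split_ifs <;> rfl
  rw [hcub]
  have hdc : ∑ x : F, ((univ.filter
        (fun t : F => (2 * t + A) * x ^ 2 + B * x + C₀ - t ^ 2 = 0)).card : ℤ)
      = ∑ t : F, ((univ.filter
        (fun x : F => (2 * t + A) * x ^ 2 + B * x + (C₀ - t ^ 2) = 0)).card : ℤ) := by
    simp only [Finset.card_filter, Nat.cast_sum]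
    rw [Finset.sum_comm]
    simp only [add_sub_assoc]
  have hx : ∀ t : F, ((univ.filter
        (fun x : F => (2 * t + A) * x ^ 2 + B * x + (C₀ - t ^ 2) = 0)).card : ℤ)
      = 1 + quadChar F (B ^ 2 - 4 * (2 * t + A) * (C₀ - t ^ 2))
        - (if t = -A / 2 then 1 else 0) := by
    intro t
    split_ifs with ht
    · have h0 : 2 * t + A = 0 := by rw [ht]; field_simp; ring
      simp only [h0]
      by_cases hB : B = 0
      · have hne : C₀ - t ^ 2 ≠ 0 := by
          intro hC
          have hfac : (X ^ 4 + C A * X ^ 2 + C B * X + C C₀ : Polynomial F)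
              = (X ^ 2 - C t) * (X ^ 2 - C t) := by
            have e1 : A = - 2 * t := by linear_combination h0
            have e2 : C₀ = t ^ 2 := by linear_combination hC
            rw [e1, e2, hB]
            simp only [map_mul, map_neg, map_pow, map_zero, map_ofNat]
            ring
          have hu := hsf (X ^ 2 - C t) (by rw [hfac])
          have hd := Polynomial.natDegree_eq_zero_of_isUnit hu
          rw [Polynomial.natDegree_X_pow_sub_C] at hd
          omega
        simp [hB, hne, quadChar]
      · have : (univ.filter (fun x : F => 0 * x ^ 2 + B * x + (C₀ - t ^ 2) = 0))
            = {-(C₀ - t ^ 2) / B} := by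
          ext x
          simp only [mem_filter, mem_univ, true_and, mem_singleton]
          rw [eq_div_iff hB]
          constructor
          · intro h; linear_combination h
          · intro h; linear_combination h
        rw [this]
        have hq : quadChar F (B ^ 2 - 4 * 0 * (C₀ - t ^ 2)) = 1 := by
          have : B ^ 2 - 4 * 0 * (C₀ - t ^ 2) = B ^ 2 := by ring
          rw [this]
          have hsq : IsSquare (B ^ 2) := ⟨B, by ring⟩
          simp [quadChar, hB, hsq]
        rw [hq]; simp
    · have h0 : 2 * t + A ≠ 0 := by
        intro h
        apply ht
        rw [eq_div_iff h2']
        linear_combination h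
      rw [card_x_aux F h2 _ _ _ h0]; ring
  simp only [card_t_aux F h2, hx] at hdc
  simp only [sum_sub_distrib, sum_add_distrib, sum_ite_eq', mem_univ, if_true] at hdc
  linarith
end

section
/- Let F_q be a finite field of characteristic greater than 3 and let α, β ∈ F_q. Then the number of triples (A,B,C) ∈ F_q³ satisfying the two equations −C/4 − A²/48 = α and A³/864 + B²/64 − A·C/24 = β equals q + Σ_{X∈F_q} χ(X³ + αX + β) (an identity of integers). -/
open Finset
open scoped Classical

/-- Over a finite field of characteristic `> 3`, for `α, β ∈ F_q` the number of triples
`(A,B,C)` with `−C/4 − A²/48 = α` and `A³/864 + B²/64 − A·C/24 = β` equals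
`q + Σ_X χ(X³ + αX + β)`. -/
theorem stmt_14 (F : Type*) [Field F] [Fintype F] (hchar : 3 < ringChar F) (α β : F) :
    ((Finset.univ.filter (fun t : F × F × F =>
        -t.2.2 / 4 - t.1 ^ 2 / 48 = α ∧
        t.1 ^ 3 / 864 + t.2.1 ^ 2 / 64 - t.1 * t.2.2 / 24 = β)).card : ℤ)
      = (Fintype.card F : ℤ) + ∑ X : F, quadChar F (X ^ 3 + α * X + β) := by
  have h2 : (2 : F) ≠ 0 := by
    intro h
    have := Nat.le_of_dvd (by norm_num) (ringChar.dvd (R := F) (x := 2) (by exact_mod_cast h))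
    omega
  have h3 : (3 : F) ≠ 0 := by
    intro h
    have := Nat.le_of_dvd (by norm_num) (ringChar.dvd (R := F) (x := 3) (by exact_mod_cast h))
    omega
  have e4 : (4 : F) = 2 ^ 2 := by norm_num
  have e6 : (6 : F) = 2 * 3 := by norm_num
  have e8 : (8 : F) = 2 ^ 3 := by norm_num
  have e48 : (48 : F) = 2 ^ 4 * 3 := by norm_num
  have e864 : (864 : F) = 2 ^ 5 * 3 ^ 3 := by norm_num
  have e64 : (64 : F) = 2 ^ 6 := by norm_num
  have e24 : (24 : F) = 2 ^ 3 * 3 := by norm_num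
  have hq : ∀ a : F, quadChar F a = quadraticChar F a := by
    intro a
    simp only [quadChar, quadraticChar_apply, quadraticCharFun]
    split_ifs <;> rfl
  have key : (Finset.univ.filter (fun t : F × F × F =>
        -t.2.2 / 4 - t.1 ^ 2 / 48 = α ∧
        t.1 ^ 3 / 864 + t.2.1 ^ 2 / 64 - t.1 * t.2.2 / 24 = β)).card
      = (Finset.univ.sigma (fun X : F => {y : F | y ^ 2 = X ^ 3 + α * X + β}.toFinset)).card := by
    refine Finset.card_bij' (fun t _ => ⟨-t.1 / 6, t.2.1 / 8⟩)
      (fun s _ => (-6 * s.1, 8 * s.2, -4 * α - 12 * s.1 ^ 2 / 4)) ?_ ?_ ?_ ?_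
    · rintro ⟨A, B, C⟩ h
      simp only [Finset.mem_filter, Finset.mem_univ, true_and] at h
      obtain ⟨ha, hb⟩ := h
      simp only [Finset.mem_sigma, Finset.mem_univ, true_and, Set.mem_toFinset, Set.mem_ofPred_eq]
      rw [← hb, ← ha, e4, e6, e8, e48, e864, e64, e24]
      field_simp
      ring
    · rintro ⟨X, y⟩ h
      simp only [Finset.mem_sigma, Finset.mem_univ, true_and, Set.mem_toFinset,
        Set.mem_ofPred_eq] at h
      have hb : β = y ^ 2 - X ^ 3 - α * X := by rw [h]; ring
      simp only [Finset.mem_filter, Finset.mem_univ, true_and]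
      rw [hb, e4, e6, e8, e48, e864, e64, e24]
      constructor
      · field_simp
        ring
      · field_simp
        ring
    · rintro ⟨A, B, C⟩ h
      simp only [Finset.mem_filter, Finset.mem_univ, true_and] at h
      obtain ⟨ha, hb⟩ := h
      simp only [Prod.mk.injEq]
      rw [← ha, e4, e6, e8, e48]
      refine ⟨?_, ?_, ?_⟩
      · field_simp
      · field_simp
      · field_simp
        ring
    · rintro ⟨X, y⟩ h
      have a1 : -(-6 * X) / 6 = X := by rw [e6]; field_simp
      have a2 : 8 * y / 8 = y := by rw [e8]; field_simp
      simp only [a1, a2]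
  rw [key, Finset.card_sigma]
  push_cast
  have hc : ringChar F ≠ 2 := by omega
  have : ∀ X : F, ((({y : F | y ^ 2 = X ^ 3 + α * X + β}.toFinset).card : ℕ) : ℤ)
      = quadChar F (X ^ 3 + α * X + β) + 1 := by
    intro X
    rw [hq, ← quadraticChar_card_sqrts hc]
  rw [Finset.sum_congr rfl (fun X _ => this X), Finset.sum_add_distrib]
  simp [add_comm]
end
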